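/- Suppose the central arrangement A defined by l_1,…,l_p is free, is irreducible, and is essential, i.e. ⋂_{i=1}^p ker l_i = {0} (so p ≥ n). Then every b in the Bernstein ideal B(A) is divisible in ℂ[s_1,…,s_p] by the polynomial ∏_{j=0}^{2(p−n)} (s_1 + ⋯ + s_p + n + j). -/

import Mathlib

open MvPolynomial

namespace Arrangement

variable {n : ℕ} {ι : Type} [Fintype ι]

/-- The module `D(A)` of logarithmic derivations of the arrangement defined by
the forms `l i`. -/
noncomputable def DA (l : ι → MvPolynomial (Fin n) ℂ) :
    Submodule (MvPolynomial (Fin n) ℂ)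
      (Derivation ℂ (MvPolynomial (Fin n) ℂ) (MvPolynomial (Fin n) ℂ)) where
  carrier := {χ | ∀ i, χ (l i) ∈ Ideal.span {l i}}
  add_mem' := fun hx hy i => by
    simpa using add_mem (hx i) (hy i)
  zero_mem' := fun i => by simp
  smul_mem' := fun r χ hχ i => by
    simpa using Ideal.mul_mem_left _ r (hχ i)

open Classical in
/-- The property characterizing the family of twisted derivatives
`D i = ∂/∂xᵢ + ∑ⱼ sⱼ (∂lⱼ/∂xᵢ)/lⱼ` acting on the localization
`M = ℂ[x,s,1/F]·l^s`. -/
def IsTwisted (l : ι → MvPolynomial (Fin n) ℂ)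
    (D : Fin n → Module.End ℂ
      (Localization.Away (rename Sum.inl (∏ i, l i) : MvPolynomial (Fin n ⊕ ι) ℂ))) : Prop :=
  (∀ (i : Fin n) (r : MvPolynomial (Fin n ⊕ ι) ℂ)
      (m : Localization.Away (rename Sum.inl (∏ i, l i) : MvPolynomial (Fin n ⊕ ι) ℂ)),
      D i (algebraMap _ _ r * m)
        = algebraMap _ _ (pderiv (Sum.inl i) r) * m + algebraMap _ _ r * D i m) ∧
  (∀ i : Fin n,
      algebraMap (MvPolynomial (Fin n ⊕ ι) ℂ) _ (rename Sum.inl (∏ j, l j)) * D i 1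
        = algebraMap _ _ (∑ j, X (Sum.inr j) *
            rename Sum.inl (pderiv i (l j) * ∏ k ∈ Finset.univ.erase j, l k)))

/-- The algebra `W` of operators on `M`, image of the Weyl algebra
`Aₙ(ℂ)[s₁,…,s_p]` acting on `ℂ[x,s,1/F]·l^s`. -/
noncomputable def Wa (l : ι → MvPolynomial (Fin n) ℂ)
    (D : Fin n → Module.End ℂ
      (Localization.Away (rename Sum.inl (∏ i, l i) : MvPolynomial (Fin n ⊕ ι) ℂ))) :
    Subalgebra ℂ (Module.End ℂ
      (Localization.Away (rename Sum.inl (∏ i, l i) : MvPolynomial (Fin n ⊕ ι) ℂ))) :=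
  Algebra.adjoin ℂ
    ((Set.range fun i : Fin n =>
        LinearMap.mulLeft ℂ (algebraMap _ _ (X (Sum.inl i) : MvPolynomial (Fin n ⊕ ι) ℂ))) ∪
     (Set.range fun j : ι =>
        LinearMap.mulLeft ℂ (algebraMap _ _ (X (Sum.inr j) : MvPolynomial (Fin n ⊕ ι) ℂ))) ∪
     Set.range D)

/-- The Bernstein ideal `B(A)`, as the set of polynomials `b(s₁,…,s_p)` such that
`b · l^s = P · l^{s+1}` for some operator `P` in the Weyl algebra. -/
noncomputable def Bideal (l : ι → MvPolynomial (Fin n) ℂ)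
    (D : Fin n → Module.End ℂ
      (Localization.Away (rename Sum.inl (∏ i, l i) : MvPolynomial (Fin n ⊕ ι) ℂ))) :
    Set (MvPolynomial ι ℂ) :=
  {b | ∃ P ∈ Wa l D,
    algebraMap (MvPolynomial (Fin n ⊕ ι) ℂ) _ ((rename Sum.inr b : MvPolynomial (Fin n ⊕ ι) ℂ))
      = P (algebraMap _ _ (rename Sum.inl (∏ i, l i) : MvPolynomial (Fin n ⊕ ι) ℂ))}

/-- The linear functional on `ℂⁿ` associated to a linear form. -/
noncomputable def toLin (f : MvPolynomial (Fin n) ℂ) : (Fin n → ℂ) →ₗ[ℂ] ℂ :=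
  ∑ i, f.coeff (Finsupp.single i 1) • LinearMap.proj i

/-- The hyperplane `ker lᵢ ⊆ ℂⁿ`. -/
noncomputable def hyp (l : ι → MvPolynomial (Fin n) ℂ) (i : ι) : Submodule ℂ (Fin n → ℂ) :=
  LinearMap.ker (toLin (l i))

open Classical in
/-- The intersection lattice `L(A)`: all intersections of nonempty subfamilies. -/
noncomputable def LA (l : ι → MvPolynomial (Fin n) ℂ) : Finset (Submodule ℂ (Fin n → ℂ)) :=
  (Finset.univ.powerset.filter Finset.Nonempty).image fun I : Finset ι => ⨅ i ∈ I, hyp l i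

open Classical in
/-- `J(X) = {i : X ⊆ ker lᵢ}`. -/
noncomputable def JX (l : ι → MvPolynomial (Fin n) ℂ) (Y : Submodule ℂ (Fin n → ℂ)) :
    Finset ι :=
  Finset.univ.filter fun i => Y ≤ hyp l i

/-- `r(X) = n - dim X`, the codimension. -/
noncomputable def rX (Y : Submodule ℂ (Fin n → ℂ)) : ℕ :=
  n - Module.finrank ℂ Y

/-- Irreducibility of the subarrangement with hyperplanes indexed by `J`. -/
def IrredOn (l : ι → MvPolynomial (Fin n) ℂ) (J : Finset ι) : Prop :=
  ¬ ∃ V₁ V₂ : Submodule ℂ (Fin n → ℂ), IsCompl V₁ V₂ ∧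
      (∀ i ∈ J, V₁ ≤ hyp l i ∨ V₂ ≤ hyp l i) ∧
      (∃ i ∈ J, V₁ ≤ hyp l i) ∧ (∃ i ∈ J, V₂ ≤ hyp l i)

open Classical in
/-- `L'(A) = {X ∈ L(A) : A_X irreducible}`. -/
noncomputable def Lprime (l : ι → MvPolynomial (Fin n) ℂ) :
    Finset (Submodule ℂ (Fin n → ℂ)) :=
  (LA l).filter fun Y => IrredOn l (JX l Y)

/-- The polynomial
`b_A = ∏_{X ∈ L'(A)} ∏_{j=0}^{2(card J(X) − r(X))} ((∑_{i ∈ J(X)} sᵢ) + r(X) + j)`. -/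
noncomputable def bGen (l : ι → MvPolynomial (Fin n) ℂ) : MvPolynomial ι ℂ :=
  ∏ Y ∈ Lprime l, ∏ j ∈ Finset.range (2 * ((JX l Y).card - rX (n := n) Y) + 1),
    ((∑ i ∈ JX l Y, X i) + C ((rX (n := n) Y : ℂ) + (j : ℂ)))

end Arrangement

namespace Arrangement

section Koszul

variable {R : Type*} [CommRing R] {n : ℕ}

theorem Basis.mem_ideal_smul_top_iff {I M : Type*} [Finite I] [AddCommGroup M] [Module R M]
    (b : Module.Basis I R M) (Y : Ideal R) (z : M) :
    z ∈ Y • (⊤ : Submodule R M) ↔ ∀ i, b.repr z i ∈ Y := by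
  have := Fintype.ofFinite I
  constructor
  · intro hz i
    refine Submodule.smul_induction_on hz (fun r hr m _ => ?_) (fun x y hx hy => ?_)
    · simpa using Y.mul_mem_right _ hr
    · simpa using Y.add_mem hx hy
  · intro h
    rw [← b.sum_repr z]
    exact Submodule.sum_mem _ fun i _ => Submodule.smul_mem_smul (h i) trivial

/-- The linear functional with coefficients `f`, whose contraction is the Koszul differential. -/
noncomputable def koszulDual (f : Fin n → R) : Module.Dual R (Fin n → R) :=
  ∑ j, f j • LinearMap.proj j

theorem koszulDual_apply (f g : Fin n → R) : koszulDual f g = ∑ j, f j * g j := by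
  simp [koszulDual]

/-- The Koszul differential on the exterior algebra. -/
noncomputable def koszulD (f : Fin n → R) :
    ExteriorAlgebra R (Fin n → R) →ₗ[R] ExteriorAlgebra R (Fin n → R) :=
  CliffordAlgebra.contractLeft (koszulDual f)

theorem koszulD_koszulD (f : Fin n → R) (x : ExteriorAlgebra R (Fin n → R)) :
    koszulD f (koszulD f x) = 0 :=
  CliffordAlgebra.contractLeft_contractLeft _ _

theorem koszulD_ι_mul (f c : Fin n → R) (x : ExteriorAlgebra R (Fin n → R)) :
    koszulD f (ExteriorAlgebra.ι R c * x)
      = (∑ j, f j * c j) • x - ExteriorAlgebra.ι R c * koszulD f x := by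
  rw [← koszulDual_apply]
  exact CliffordAlgebra.contractLeft_ι_mul _ _ _

theorem koszulD_mem_smul_top (f : Fin n → R) (Y : Ideal R) {x : ExteriorAlgebra R (Fin n → R)}
    (hx : x ∈ Y • (⊤ : Submodule R (ExteriorAlgebra R (Fin n → R)))) :
    koszulD f x ∈ Y • (⊤ : Submodule R (ExteriorAlgebra R (Fin n → R))) := by
  refine Submodule.smul_induction_on hx (fun r hr m _ => ?_) (fun x y hx hy => ?_)
  · rw [map_smul]
    exact Submodule.smul_mem_smul hr trivial
  · rw [map_add]
    exact Submodule.add_mem _ hx hy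

theorem mul_mem_smul_top (Y : Ideal R) (a : ExteriorAlgebra R (Fin n → R))
    {x : ExteriorAlgebra R (Fin n → R)}
    (hx : x ∈ Y • (⊤ : Submodule R (ExteriorAlgebra R (Fin n → R)))) :
    a * x ∈ Y • (⊤ : Submodule R (ExteriorAlgebra R (Fin n → R))) := by
  refine Submodule.smul_induction_on hx (fun r hr m _ => ?_) (fun x y hx hy => ?_)
  · rw [mul_smul_comm]
    exact Submodule.smul_mem_smul hr trivial
  · rw [mul_add]
    exact Submodule.add_mem _ hx hy

theorem exteriorPower_eq_zero_of_lt {i : ℕ} (hi : n < i) {z : ExteriorAlgebra R (Fin n → R)}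
    (hz : z ∈ ⋀[R]^i (Fin n → R)) : z = 0 := by
  have hb := (Pi.basisFun R (Fin n)).exteriorPower i
  have : IsEmpty (Set.powersetCard (Fin n) i) := by
    constructor
    rintro ⟨s, hs⟩
    have := Finset.card_le_univ s
    simp at this hs
    omega
  have : Subsingleton (⋀[R]^i (Fin n → R)) := hb.repr.toEquiv.subsingleton
  exact congrArg Subtype.val (Subsingleton.elim (⟨z, hz⟩ : ⋀[R]^i (Fin n → R)) 0)

/-- Depth sensitivity of the Koszul complex: if the ideal generated by `f` contains a regular
sequence `y` of length `n`, then modulo the first `k` terms of `y` the Koszul complex is exact in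
degrees above `k`. -/
theorem koszul_exact_mod (f : Fin n → R) (y : ℕ → R)
    (hy : ∀ k < n, y k ∈ Ideal.span (Set.range f))
    (hreg : ∀ k < n, ∀ a, y k * a ∈ Ideal.span (y '' Set.Iio k) → a ∈ Ideal.span (y '' Set.Iio k))
    (m : ℕ) : ∀ k, k + m = n → ∀ i, k < i → ∀ z ∈ ⋀[R]^i (Fin n → R),
      koszulD f z ∈ Ideal.span (y '' Set.Iio k) •
        (⊤ : Submodule R (ExteriorAlgebra R (Fin n → R))) →
      ∃ v, z - koszulD f v ∈ Ideal.span (y '' Set.Iio k) •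
        (⊤ : Submodule R (ExteriorAlgebra R (Fin n → R))) := by
  induction m with
  | zero =>
    intro k hk i hi z hz _
    refine ⟨0, ?_⟩
    rw [exteriorPower_eq_zero_of_lt (by omega) hz]
    simp
  | succ m ih =>
    intro k hk i hi z hz hdz
    have hspan : Ideal.span (y '' Set.Iio (k + 1))
        = Ideal.span {y k} ⊔ Ideal.span (y '' Set.Iio k) := by
      rw [← Ideal.span_union, ← Set.image_singleton, ← Set.image_union]
      congr 2
      ext a
      simp only [Set.mem_Iio, Set.mem_union, Set.mem_singleton_iff,
        Nat.lt_succ_iff_lt_or_eq, or_comm]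
    obtain ⟨c, hc⟩ := Ideal.mem_span_range_iff_exists_fun.1 (hy k (by omega))
    set w := ExteriorAlgebra.ι R c * z with hw
    have hdw : koszulD f w = y k • z - ExteriorAlgebra.ι R c * koszulD f z := by
      rw [hw, koszulD_ι_mul, ← hc]
      simp only [mul_comm]
    have hwmem : w ∈ ⋀[R]^(i + 1) (Fin n → R) := by
      rw [ExteriorAlgebra.exteriorPower, pow_succ']
      exact Submodule.mul_mem_mul ⟨c, rfl⟩ hz
    have h1 : koszulD f w ∈ Ideal.span (y '' Set.Iio (k + 1)) •
        (⊤ : Submodule R (ExteriorAlgebra R (Fin n → R))) := by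
      rw [hdw]
      refine Submodule.sub_mem _ (Submodule.smul_mem_smul ?_ trivial) ?_
      · exact Ideal.subset_span ⟨k, by simp, rfl⟩
      · refine Submodule.smul_mono_left ?_ (mul_mem_smul_top _ _ hdz)
        rw [hspan]; exact le_sup_right
    obtain ⟨v, hv⟩ := ih (k + 1) (by omega) (i + 1) (by omega) w hwmem h1
    rw [hspan, Submodule.sup_smul, Submodule.mem_sup] at hv
    obtain ⟨a, ha, r, hr, har⟩ := hv
    rw [Submodule.ideal_span_singleton_smul] at ha
    obtain ⟨w', -, rfl⟩ := (Submodule.mem_smul_pointwise_iff_exists _ _ _).1 ha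
    refine ⟨w', ?_⟩
    have key : y k • (z - koszulD f w') = ExteriorAlgebra.ι R c * koszulD f z + koszulD f r := by
      have : koszulD f w = koszulD f (y k • w' + r) := by
        rw [har, map_sub, koszulD_koszulD, sub_zero]
      rw [hdw, map_add, map_smul] at this
      rw [smul_sub, sub_eq_iff_eq_add]
      rw [sub_eq_iff_eq_add] at this
      rw [this]; abel
    have hmem : y k • (z - koszulD f w') ∈ Ideal.span (y '' Set.Iio k) •
        (⊤ : Submodule R (ExteriorAlgebra R (Fin n → R))) := by
      rw [key]
      exact Submodule.add_mem _ (mul_mem_smul_top _ _ hdz) (koszulD_mem_smul_top _ _ hr)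
    rw [Basis.mem_ideal_smul_top_iff (Pi.basisFun R (Fin n)).ExteriorAlgebra] at hmem ⊢
    intro s
    refine hreg k (by omega) _ ?_
    simpa using hmem s

/-- If the ideal generated by `f` contains a regular sequence of length `n`, then every syzygy of
`f` is a combination of the Koszul syzygies. -/
theorem exists_antisymm_of_syzygy (f : Fin n → R) (y : ℕ → R)
    (hy : ∀ k < n, y k ∈ Ideal.span (Set.range f))
    (hreg : ∀ k < n, ∀ a, y k * a ∈ Ideal.span (y '' Set.Iio k) → a ∈ Ideal.span (y '' Set.Iio k))
    (g : Fin n → R) (hg : ∑ i, f i * g i = 0) :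
    ∃ c : Fin n → Fin n → R, (∀ i j, c i j = - c j i) ∧ ∀ i, g i = ∑ j, f j * c i j := by
  obtain ⟨v, hv⟩ := koszul_exact_mod f y hy hreg n 0 (by omega) 1 one_pos
    (ExteriorAlgebra.ι R g) (by rw [ExteriorAlgebra.exteriorPower, pow_one]; exact ⟨g, rfl⟩) (by
      have : koszulD f (ExteriorAlgebra.ι R g) = 0 := by
        have := koszulD_ι_mul f g 1
        simp only [mul_one, hg, zero_smul] at this
        rw [this, koszulD, CliffordAlgebra.contractLeft_one]
        simp
      rw [this]
      exact Submodule.zero_mem _)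
  have h0 : y '' Set.Iio 0 = ∅ := by simp
  rw [h0, Ideal.span_empty, Submodule.bot_smul, Submodule.mem_bot, sub_eq_zero] at hv
  let e : Fin n → Module.Dual R (Fin n → R) := fun i => LinearMap.proj i
  let κ : Fin n → ExteriorAlgebra R (Fin n → R) →ₗ[R] ExteriorAlgebra R (Fin n → R) :=
    fun i => CliffordAlgebra.contractLeft (e i)
  have hκ : koszulD f v = ∑ j, f j • κ j v := by
    simp [koszulD, koszulDual, κ, e]
  refine ⟨fun i j => ExteriorAlgebra.algebraMapInv (κ i (κ j v)), fun i j => ?_, fun i => ?_⟩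
  · rw [← map_neg]
    exact congrArg _ (CliffordAlgebra.contractLeft_comm _ _ v)
  · have h1 : κ i (ExteriorAlgebra.ι R g) = algebraMap R _ (g i) :=
      CliffordAlgebra.contractLeft_ι _ _ _
    have h2 := congrArg (fun x => ExteriorAlgebra.algebraMapInv (κ i x)) hv
    simp only [h1, hκ, map_sum, map_smul] at h2
    rw [ExteriorAlgebra.algebraMap_leftInverse] at h2
    simpa using h2

end Koszul

section CompleteIntersection

variable {n : ℕ}

theorem homogeneousComponent_mul_of_le {σ R : Type*} [CommSemiring R] {f : MvPolynomial σ R}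
    {e d : ℕ} (hf : f.IsHomogeneous e) (hed : e ≤ d) (b : MvPolynomial σ R) :
    homogeneousComponent d (f * b) = f * homogeneousComponent (d - e) b := by
  conv_lhs => rw [← sum_homogeneousComponent b, Finset.mul_sum, map_sum]
  have : ∀ i, homogeneousComponent d (f * homogeneousComponent i b)
      = if i = d - e then f * homogeneousComponent (d - e) b else 0 := by
    intro i
    have h1 : f * homogeneousComponent i b ∈ homogeneousSubmodule σ R (e + i) :=
      hf.mul (homogeneousComponent_isHomogeneous i b)
    rw [homogeneousComponent_of_mem h1]
    by_cases h : i = d - e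
    · subst h; rw [if_pos (by omega), if_pos rfl]
    · rw [if_neg (by omega), if_neg h]
  rw [Finset.sum_congr rfl fun i _ => this i, Finset.sum_ite_eq']
  split_ifs with h
  · rfl
  · rw [homogeneousComponent_eq_zero, mul_zero]
    have := Finset.mem_range.not.1 h
    omega

theorem homogeneousComponent_mul_of_lt {σ R : Type*} [CommSemiring R] {f : MvPolynomial σ R}
    {e d : ℕ} (hf : f.IsHomogeneous e) (hed : d < e) (b : MvPolynomial σ R) :
    homogeneousComponent d (f * b) = 0 := by
  conv_lhs => rw [← sum_homogeneousComponent b, Finset.mul_sum, map_sum]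
  refine Finset.sum_eq_zero fun i _ => ?_
  have h1 : f * homogeneousComponent i b ∈ homogeneousSubmodule σ R (e + i) :=
    hf.mul (homogeneousComponent_isHomogeneous i b)
  rw [homogeneousComponent_of_mem h1, if_neg (by omega)]

/-- An ideal that contains the homogeneous components of its elements. -/
def IsGradedIdeal (I : Ideal (MvPolynomial (Fin n) ℂ)) : Prop :=
  ∀ a ∈ I, ∀ d, homogeneousComponent d a ∈ I

theorem IsGradedIdeal.mem_iff {I : Ideal (MvPolynomial (Fin n) ℂ)} (hI : IsGradedIdeal I)
    {a : MvPolynomial (Fin n) ℂ} : a ∈ I ↔ ∀ d, homogeneousComponent d a ∈ I := by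
  refine ⟨hI a, fun h => ?_⟩
  rw [← sum_homogeneousComponent a]
  exact Ideal.sum_mem _ fun d _ => h d

theorem isGradedIdeal_span {S : Set (MvPolynomial (Fin n) ℂ)}
    (hS : ∀ f ∈ S, ∃ e, f.IsHomogeneous e) : IsGradedIdeal (Ideal.span S) := by
  intro a ha
  refine Submodule.span_induction
    (p := fun a _ => ∀ d, homogeneousComponent d a ∈ Ideal.span S) ?_ ?_ ?_ ?_ ha
  · intro f hf d
    obtain ⟨e, he⟩ := hS f hf
    rw [homogeneousComponent_of_mem (m := d) he]
    split_ifs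
    · exact Ideal.subset_span hf
    · exact Ideal.zero_mem _
  · intro d
    simp
  · intro x y _ _ hx hy d
    rw [map_add]
    exact Ideal.add_mem _ (hx d) (hy d)
  · intro r x _ hx d
    rw [smul_eq_mul, ← sum_homogeneousComponent r, Finset.sum_mul, map_sum]
    refine Ideal.sum_mem _ fun i _ => ?_
    rcases le_or_gt i d with h | h
    · rw [homogeneousComponent_mul_of_le (homogeneousComponent_isHomogeneous i r) h]
      exact Ideal.mul_mem_left _ _ (hx _)
    · rw [homogeneousComponent_mul_of_lt (homogeneousComponent_isHomogeneous i r) h]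
      exact Ideal.zero_mem _

/-- Powers of the variables form a regular sequence. -/
theorem X_pow_regular {K : Type*} [Field K] (M k : ℕ) (hk : k < n) (a : MvPolynomial (Fin n) K)
    (ha : X ⟨k, hk⟩ ^ M * a ∈
      Ideal.span {f : MvPolynomial (Fin n) K | ∃ j : Fin n, j.val < k ∧ f = X j ^ M}) :
    a ∈ Ideal.span {f : MvPolynomial (Fin n) K | ∃ j : Fin n, j.val < k ∧ f = X j ^ M} := by
  have hset : {f : MvPolynomial (Fin n) K | ∃ j : Fin n, j.val < k ∧ f = X j ^ M}
      = (fun s => monomial s (1 : K)) '' {s | ∃ j : Fin n, j.val < k ∧ s = Finsupp.single j M} := by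
    ext f
    simp only [Set.mem_ofPred_eq, Set.mem_image]
    constructor
    · rintro ⟨j, hj, rfl⟩
      exact ⟨_, ⟨j, hj, rfl⟩, by rw [X_pow_eq_monomial]⟩
    · rintro ⟨_, ⟨j, hj, rfl⟩, rfl⟩
      exact ⟨j, hj, by rw [X_pow_eq_monomial]⟩
  rw [hset, mem_ideal_span_monomial_image] at ha ⊢
  intro m hm
  have hm' : Finsupp.single (⟨k, hk⟩ : Fin n) M + m ∈ (X (⟨k, hk⟩ : Fin n) ^ M * a).support := by
    rw [mem_support_iff, X_pow_eq_monomial, coeff_monomial_mul, one_mul]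
    exact mem_support_iff.1 hm
  obtain ⟨_, ⟨j, hj, rfl⟩, hle⟩ := ha _ hm'
  refine ⟨_, ⟨j, hj, rfl⟩, ?_⟩
  rw [Finsupp.single_le_iff] at hle ⊢
  have hne : (⟨k, hk⟩ : Fin n) ≠ j := by rintro rfl; exact lt_irrefl _ hj
  simpa [Finsupp.single_apply, hne] using hle

/-- Syzygies of `n` polynomials in `n` variables whose only common zero is the origin are
trivial. -/
theorem exists_antisymm_of_zeros (f : Fin n → MvPolynomial (Fin n) ℂ)
    (hV : ∀ x : Fin n → ℂ, (∀ i, eval x (f i) = 0) → x = 0)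
    (g : Fin n → MvPolynomial (Fin n) ℂ) (hg : ∑ i, f i * g i = 0) :
    ∃ c : Fin n → Fin n → MvPolynomial (Fin n) ℂ,
      (∀ i j, c i j = - c j i) ∧ ∀ i, g i = ∑ j, f j * c i j := by
  have hrad : ∀ i, X i ∈ (Ideal.span (Set.range f)).radical := by
    intro i
    rw [← vanishingIdeal_zeroLocus_eq_radical (K := ℂ), mem_vanishingIdeal_iff]
    intro x hx
    rw [mem_zeroLocus_iff] at hx
    have : x = 0 := hV x fun i => by
      simpa [coe_aeval_eq_eval] using hx (f i) (Ideal.subset_span ⟨i, rfl⟩)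
    simp [this]
  choose N hN using hrad
  set M := ∑ i, N i
  have hM : ∀ i, X i ^ M ∈ Ideal.span (Set.range f) := fun i =>
    Ideal.pow_mem_of_pow_mem _ (hN i)
      (Finset.single_le_sum (fun _ _ => Nat.zero_le _) (Finset.mem_univ i))
  let y : ℕ → MvPolynomial (Fin n) ℂ := fun k => if h : k < n then X ⟨k, h⟩ ^ M else 0
  have hyk : ∀ k (h : k < n), y k = X ⟨k, h⟩ ^ M := fun k h => dif_pos h
  have hset : ∀ k, k < n → y '' Set.Iio k =
      {f : MvPolynomial (Fin n) ℂ | ∃ j : Fin n, j.val < k ∧ f = X j ^ M} := by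
    intro k hk
    ext q
    constructor
    · rintro ⟨j, hj, rfl⟩
      exact ⟨⟨j, lt_trans hj hk⟩, hj, hyk _ _⟩
    · rintro ⟨j, hj, rfl⟩
      exact ⟨j, hj, hyk _ _⟩
  refine exists_antisymm_of_syzygy f y (fun k hk => ?_) (fun k hk a ha => ?_) g hg
  · rw [hyk k hk]; exact hM _
  · rw [hset k hk] at ha ⊢
    rw [hyk k hk] at ha
    exact X_pow_regular M k hk a ha

/-- Homogeneous polynomials of positive degree whose only common zero is the origin form a regular
sequence when their number is the number of variables. -/
theorem regular_of_zeros (f : Fin n → MvPolynomial (Fin n) ℂ) (e : Fin n → ℕ)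
    (hf : ∀ i, (f i).IsHomogeneous (e i)) (he : ∀ i, 1 ≤ e i)
    (hV : ∀ x : Fin n → ℂ, (∀ i, eval x (f i) = 0) → x = 0)
    (k : Fin n) (a : MvPolynomial (Fin n) ℂ) (ha : f k * a ∈ Ideal.span (f '' Set.Iio k)) :
    a ∈ Ideal.span (f '' Set.Iio k) := by
  have hhom : IsGradedIdeal (Ideal.span (f '' Set.Iio k)) := by
    refine isGradedIdeal_span ?_
    rintro _ ⟨j, -, rfl⟩
    exact ⟨e j, hf j⟩
  rw [hhom.mem_iff]
  intro d
  let f' : Fin n → MvPolynomial (Fin n) ℂ := fun i => if i ≤ k then f i else f i ^ (d + 1)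
  have hV' : ∀ x : Fin n → ℂ, (∀ i, eval x (f' i) = 0) → x = 0 := by
    refine fun x hx => hV x fun i => ?_
    have := hx i
    by_cases h : i ≤ k
    · simpa [f', h] using this
    · simpa [f', h] using this
  obtain ⟨u, hu⟩ : ∃ u : Fin n → MvPolynomial (Fin n) ℂ, (∀ j, ¬ j < k → u j = 0) ∧
      ∑ j, u j * f j = f k * a := by
    refine Submodule.span_induction (p := fun q _ => ∃ u : Fin n → MvPolynomial (Fin n) ℂ,
      (∀ j, ¬ j < k → u j = 0) ∧ ∑ j, u j * f j = q) ?_ ?_ ?_ ?_ ha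
    · rintro _ ⟨j, hj, rfl⟩
      refine ⟨Pi.single j 1, fun i hi => ?_, ?_⟩
      · refine Pi.single_eq_of_ne ?_ _
        rintro rfl
        exact hi hj
      · simp [Pi.single_apply]
    · exact ⟨0, by simp, by simp⟩
    · rintro _ _ - - ⟨u, hu, rfl⟩ ⟨v, hv, rfl⟩
      refine ⟨u + v, fun j hj => by simp [hu j hj, hv j hj], ?_⟩
      simp [add_mul, Finset.sum_add_distrib]
    · rintro r _ - ⟨u, hu, rfl⟩
      refine ⟨r • u, fun j hj => by simp [hu j hj], ?_⟩
      simp [Finset.mul_sum, mul_assoc]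
  obtain ⟨hu0, hu⟩ := hu
  obtain ⟨c, hc, hgc⟩ := exists_antisymm_of_zeros f' hV' (u - Pi.single k a) (by
    have : ∀ i, f' i * (u - Pi.single k a : Fin n → MvPolynomial (Fin n) ℂ) i
        = u i * f i - (Pi.single k (f k * a) : Fin n → MvPolynomial (Fin n) ℂ) i := by
      intro i
      rcases lt_trichotomy i k with h | h | h
      · simp [f', h.le, h.ne, mul_comm]
      · subst h
        simp [f', hu0 i (lt_irrefl _)]
      · simp [hu0 i h.not_gt, h.ne']
    rw [Finset.sum_congr rfl fun i _ => this i]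
    simp [hu])
  have hck : c k k = 0 := by
    have := hc k k
    exact self_eq_neg.1 this
  have hka := hgc k
  simp only [Pi.sub_apply, hu0 k (lt_irrefl _), Pi.single_eq_same, zero_sub] at hka
  rw [neg_eq_iff_eq_neg] at hka
  rw [hka, map_neg, map_sum]
  refine neg_mem (Ideal.sum_mem _ fun j _ => ?_)
  rcases lt_trichotomy j k with h | h | h
  · refine hhom _ (Ideal.mul_mem_right _ _ ?_) d
    simp only [f', h.le, if_true]
    exact Ideal.subset_span ⟨j, h, rfl⟩
  · subst h; simp [hck]
  · have : f' j = f j ^ (d + 1) := by simp [f', h]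
    rw [this, homogeneousComponent_mul_of_lt ((hf j).pow (d + 1))]
    · exact Ideal.zero_mem _
    · nlinarith [he j]

end CompleteIntersection

section Hilbert

variable {n : ℕ}

/-- The degree `d` part of an ideal. -/
noncomputable def gradedPart (I : Ideal (MvPolynomial (Fin n) ℂ)) (d : ℕ) :
    Submodule ℂ (MvPolynomial (Fin n) ℂ) :=
  I.restrictScalars ℂ ⊓ homogeneousSubmodule (Fin n) ℂ d

theorem mem_gradedPart {I : Ideal (MvPolynomial (Fin n) ℂ)} {d : ℕ} {a : MvPolynomial (Fin n) ℂ} :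
    a ∈ gradedPart I d ↔ a ∈ I ∧ a.IsHomogeneous d := by
  simp [gradedPart, Submodule.mem_inf]

instance finite_homogeneousSubmodule (d : ℕ) :
    Module.Finite ℂ (homogeneousSubmodule (Fin n) ℂ d) :=
  Module.Finite.iff_fg.2 (homogeneousSubmodule_fg (σ := Fin n) (R := ℂ) d)

instance finite_gradedPart (I : Ideal (MvPolynomial (Fin n) ℂ)) (d : ℕ) :
    Module.Finite ℂ (gradedPart I d) :=
  Submodule.finiteDimensional_of_le (inf_le_right : gradedPart I d ≤ homogeneousSubmodule _ _ d)

/-- The Hilbert series of the quotient by a graded ideal. -/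
noncomputable def hilbertSeries (I : Ideal (MvPolynomial (Fin n) ℂ)) : PowerSeries ℤ :=
  PowerSeries.mk fun d =>
    (Module.finrank ℂ (homogeneousSubmodule (Fin n) ℂ d) : ℤ) - Module.finrank ℂ (gradedPart I d)

theorem hilbertSeries_sup_span {I : Ideal (MvPolynomial (Fin n) ℂ)} (hI : IsGradedIdeal I)
    {f : MvPolynomial (Fin n) ℂ} {e : ℕ} (hf : f.IsHomogeneous e) (hf0 : f ≠ 0)
    (hreg : ∀ a, f * a ∈ I → a ∈ I) :
    hilbertSeries (I ⊔ Ideal.span {f}) = (1 - PowerSeries.X ^ e) * hilbertSeries I := by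
  ext d
  rw [sub_mul, one_mul, map_sub, PowerSeries.coeff_X_pow_mul', hilbertSeries, hilbertSeries,
    PowerSeries.coeff_mk, PowerSeries.coeff_mk]
  split_ifs with hed
  · rw [PowerSeries.coeff_mk]
    have hinj : Function.Injective (LinearMap.mulLeft ℂ f) :=
      fun a b h => mul_left_cancel₀ hf0 h
    have h1 : gradedPart (I ⊔ Ideal.span {f}) d
        = gradedPart I d ⊔
          (homogeneousSubmodule (Fin n) ℂ (d - e)).map (LinearMap.mulLeft ℂ f) := by
      apply le_antisymm
      · intro a ha
        obtain ⟨ha, had⟩ := mem_gradedPart.1 ha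
        obtain ⟨u, hu, v, hv, rfl⟩ := Submodule.mem_sup.1 ha
        obtain ⟨w, rfl⟩ := Ideal.mem_span_singleton'.1 hv
        have := homogeneousComponent_of_mem (m := d) ((mem_homogeneousSubmodule _ _).2 had)
        rw [if_pos rfl, map_add, mul_comm w f, homogeneousComponent_mul_of_le hf hed] at this
        rw [mul_comm w f, ← this]
        refine Submodule.add_mem_sup
          (mem_gradedPart.2 ⟨hI _ hu _, homogeneousComponent_isHomogeneous _ _⟩) ?_
        exact Submodule.mem_map_of_mem (homogeneousComponent_isHomogeneous _ _)
      · refine sup_le ?_ ?_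
        · intro a ha
          obtain ⟨ha, had⟩ := mem_gradedPart.1 ha
          exact mem_gradedPart.2 ⟨Ideal.mem_sup_left ha, had⟩
        · rintro _ ⟨a, ha, rfl⟩
          refine mem_gradedPart.2 ⟨Ideal.mem_sup_right ?_, ?_⟩
          · exact Ideal.mem_span_singleton.2 ⟨a, rfl⟩
          · have := hf.mul ((mem_homogeneousSubmodule _ _).1 ha)
            rwa [Nat.add_sub_cancel' hed] at this
    have h2 : gradedPart I d ⊓ (homogeneousSubmodule (Fin n) ℂ (d - e)).map (LinearMap.mulLeft ℂ f)
        = (gradedPart I (d - e)).map (LinearMap.mulLeft ℂ f) := by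
      apply le_antisymm
      · rintro _ ⟨ha, a, ha', rfl⟩
        exact ⟨a, mem_gradedPart.2 ⟨hreg a (mem_gradedPart.1 ha).1, ha'⟩, rfl⟩
      · rintro _ ⟨a, ha, rfl⟩
        obtain ⟨ha, had⟩ := mem_gradedPart.1 ha
        refine ⟨mem_gradedPart.2 ⟨Ideal.mul_mem_left _ _ ha, ?_⟩, a, had, rfl⟩
        have := hf.mul had
        rwa [Nat.add_sub_cancel' hed] at this
    have h3 := Submodule.finrank_sup_add_finrank_inf_eq (gradedPart I d)
      ((homogeneousSubmodule (Fin n) ℂ (d - e)).map (LinearMap.mulLeft ℂ f))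
    rw [← h1, h2, ← (Submodule.equivMapOfInjective _ hinj _).finrank_eq,
      ← (Submodule.equivMapOfInjective _ hinj _).finrank_eq] at h3
    omega
  · have : gradedPart (I ⊔ Ideal.span {f}) d = gradedPart I d := by
      ext a
      rw [mem_gradedPart, mem_gradedPart]
      refine and_congr_left fun had => ⟨fun ha => ?_, fun ha => Ideal.mem_sup_left ha⟩
      obtain ⟨u, hu, v, hv, rfl⟩ := Submodule.mem_sup.1 ha
      obtain ⟨w, rfl⟩ := Ideal.mem_span_singleton'.1 hv
      have := homogeneousComponent_of_mem (m := d) ((mem_homogeneousSubmodule _ _).2 had)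
      rw [if_pos rfl, map_add, mul_comm w f, homogeneousComponent_mul_of_lt hf (by omega),
        add_zero] at this
      rw [mul_comm w f, ← this]
      exact hI _ hu _
    rw [this, sub_zero]

theorem hilbertSeries_of_zeros (f : Fin n → MvPolynomial (Fin n) ℂ) (e : Fin n → ℕ)
    (hf : ∀ i, (f i).IsHomogeneous (e i)) (he : ∀ i, 1 ≤ e i) (hf0 : ∀ i, f i ≠ 0)
    (hV : ∀ x : Fin n → ℂ, (∀ i, eval x (f i) = 0) → x = 0) :
    hilbertSeries (Ideal.span (Set.range f))
      = (∏ i, (1 - PowerSeries.X ^ e i)) * hilbertSeries (n := n) ⊥ := by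
  have key : ∀ k ≤ n, hilbertSeries (Ideal.span (f '' {i | i.val < k}))
      = (∏ i with i.val < k, (1 - PowerSeries.X ^ e i)) * hilbertSeries (n := n) ⊥ := by
    intro k
    induction k with
    | zero => intro _; simp
    | succ k ih =>
      intro hk
      have hs : ({i : Fin n | i.val < k + 1} : Set (Fin n))
        = insert ⟨k, hk⟩ {i : Fin n | i.val < k} := by
        ext i
        simp only [Set.mem_ofPred_eq, Set.mem_insert_iff, Fin.ext_iff]
        omega
      have hs' : (Finset.univ.filter fun i : Fin n => i.val < k + 1)
          = insert ⟨k, hk⟩ (Finset.univ.filter fun i : Fin n => i.val < k) := by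
        ext i
        simp only [Finset.mem_filter, Finset.mem_univ, true_and, Finset.mem_insert, Fin.ext_iff]
        omega
      have hIio : ({i : Fin n | i.val < k} : Set (Fin n)) = Set.Iio ⟨k, hk⟩ := rfl
      rw [hs, Set.image_insert_eq, Ideal.span_insert, sup_comm,
        hilbertSeries_sup_span _ (hf ⟨k, hk⟩) (hf0 _), ih (by omega), hs',
      Finset.prod_insert (by simp),
        mul_assoc]
      · rw [hIio]
        exact regular_of_zeros f e hf he hV ⟨k, hk⟩
      · refine isGradedIdeal_span ?_
        rintro _ ⟨j, -, rfl⟩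
        exact ⟨e j, hf j⟩
  have := key n le_rfl
  simpa using this

theorem hilbertSeries_span_X :
    hilbertSeries (Ideal.span (Set.range (X : Fin n → MvPolynomial (Fin n) ℂ))) = 1 := by
  ext d
  rw [hilbertSeries, PowerSeries.coeff_mk, PowerSeries.coeff_one]
  have hmem : ∀ a : MvPolynomial (Fin n) ℂ,
      a ∈ Ideal.span (Set.range (X : Fin n → MvPolynomial (Fin n) ℂ)) ↔ constantCoeff a = 0 := by
    intro a
    rw [← Set.image_univ, mem_ideal_span_X_image]
    constructor
    · intro h
      by_contra h0
      obtain ⟨i, -, hi⟩ := h 0 (mem_support_iff.2 h0)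
      exact hi rfl
    · intro h0 m hm
      by_contra! h
      have : m = 0 := by ext i; exact h i (Set.mem_univ i)
      subst this
      exact mem_support_iff.1 hm h0
  have hzero : ∀ a : MvPolynomial (Fin n) ℂ, a.IsHomogeneous 0 → a = C (coeff 0 a) := by
    intro a ha
    have := homogeneousComponent_of_mem (m := 0) ((mem_homogeneousSubmodule _ _).2 ha)
    rwa [if_pos rfl, homogeneousComponent_zero, eq_comm] at this
  split_ifs with hd
  · subst hd
    have h1 : gradedPart (Ideal.span (Set.range (X : Fin n → MvPolynomial (Fin n) ℂ))) 0 = ⊥ := by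
      rw [eq_bot_iff]
      intro a ha
      obtain ⟨ha, ha0⟩ := mem_gradedPart.1 ha
      rw [hmem] at ha
      rw [hzero a ha0]
      have ha : coeff 0 a = 0 := ha
      simp [ha]
    have h2 : homogeneousSubmodule (Fin n) ℂ 0 = Submodule.span ℂ {1} := by
      ext a
      rw [Submodule.mem_span_singleton]
      constructor
      · intro ha
        refine ⟨coeff 0 a, ?_⟩
        rw [smul_eq_C_mul, mul_one]
        exact (hzero a ha).symm
      · rintro ⟨c, rfl⟩
        exact Submodule.smul_mem _ _ (isHomogeneous_one _ _)
    rw [h1, finrank_bot, h2, finrank_span_singleton one_ne_zero]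
    rfl
  · have : gradedPart (Ideal.span (Set.range (X : Fin n → MvPolynomial (Fin n) ℂ))) d
        = homogeneousSubmodule (Fin n) ℂ d := by
      refine inf_eq_right.2 fun a ha => ?_
      refine (hmem a).2 ?_
      exact (ha : a.IsHomogeneous d).coeff_eq_zero (d := 0) (by simpa using Ne.symm hd)
    rw [this, sub_self]

theorem homogeneousSubmodule_le_of_le {I : Ideal (MvPolynomial (Fin n) ℂ)} {j N : ℕ} (hjN : j ≤ N)
    (h : ∀ q : MvPolynomial (Fin n) ℂ, q.IsHomogeneous j → q ∈ I) :
    ∀ q : MvPolynomial (Fin n) ℂ, q.IsHomogeneous N → q ∈ I := by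
  induction N, hjN using Nat.le_induction with
  | base => exact h
  | succ N _ ih =>
    intro q hq
    rw [q.as_sum]
    refine Ideal.sum_mem _ fun m hm => ?_
    have hdeg : m.degree = N + 1 := by
      by_contra hne
      exact mem_support_iff.1 hm (hq.coeff_eq_zero hne)
    obtain ⟨i, hi⟩ : ∃ i, m i ≠ 0 := by
      by_contra! h0
      have : m = 0 := by ext i; exact h0 i
      simp [this] at hdeg
    have hm' : m = Finsupp.single i 1 + (m - Finsupp.single i 1) := by
      rw [add_tsub_cancel_of_le]
      rw [Finsupp.single_le_iff]
      omega
    have : monomial m (coeff m q) = X i * monomial (m - Finsupp.single i 1) (coeff m q) := by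
      rw [X, monomial_mul, one_mul, ← hm']
    rw [this]
    refine Ideal.mul_mem_left _ _ (ih _ (isHomogeneous_monomial _ ?_))
    have := congrArg Finsupp.degree hm'
    rw [map_add, hdeg, Finsupp.degree_single] at this
    omega

/-- A homogeneous complete intersection of degrees `e i` supported at the origin does not contain
all forms of degree at most `∑ (e i - 1)`. -/
theorem exists_homogeneous_notMem (f : Fin n → MvPolynomial (Fin n) ℂ) (e : Fin n → ℕ)
    (hf : ∀ i, (f i).IsHomogeneous (e i)) (he : ∀ i, 1 ≤ e i)
    (hV : ∀ x : Fin n → ℂ, (∀ i, eval x (f i) = 0) → x = 0) {j : ℕ} (hj : j ≤ ∑ i, (e i - 1)) :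
    ∃ q : MvPolynomial (Fin n) ℂ, q.IsHomogeneous j ∧ q ∉ Ideal.span (Set.range f) := by
  by_contra! hcon
  have htop := homogeneousSubmodule_le_of_le hj hcon
  have hf0 : ∀ i, f i ≠ 0 := by
    intro i hi
    have h1 : (1 : MvPolynomial (Fin n) ℂ) ∈ Ideal.span (f '' Set.Iio i) :=
      regular_of_zeros f e hf he hV i 1 (by rw [hi, zero_mul]; exact Ideal.zero_mem _)
    have h2 : Ideal.span (f '' Set.Iio i) ≤ RingHom.ker (constantCoeff (σ := Fin n) (R := ℂ)) := by
      rw [Ideal.span_le]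
      rintro _ ⟨j, -, rfl⟩
      exact (hf j).coeff_eq_zero (d := 0) (by have := he j; simp; omega)
    simpa [RingHom.mem_ker] using h2 h1
  have h1 := hilbertSeries_of_zeros f e hf he hf0 hV
  have h2 := hilbertSeries_of_zeros (n := n) X (fun _ => 1) (fun i => isHomogeneous_X _ i)
    (fun _ => le_rfl) (fun i => X_ne_zero i) (fun x hx => by ext i; simpa using hx i)
  rw [hilbertSeries_span_X] at h2
  have h3 : ∀ i : Fin n, (1 - PowerSeries.X ^ e i : PowerSeries ℤ)
      = (∑ k ∈ Finset.range (e i), PowerSeries.X ^ k) * (1 - PowerSeries.X ^ 1) := by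
    intro i
    rw [pow_one, mul_comm, mul_neg_geom_sum]
  rw [Finset.prod_congr rfl fun i _ => h3 i, Finset.prod_mul_distrib, mul_assoc, ← h2,
    mul_one] at h1
  have h4 : (∏ i, ∑ k ∈ Finset.range (e i), PowerSeries.X ^ k : PowerSeries ℤ)
      = ((∏ i, ∑ k ∈ Finset.range (e i), Polynomial.X ^ k : Polynomial ℤ) : PowerSeries ℤ) := by
    rw [← Polynomial.coeToPowerSeries.ringHom_apply, map_prod]
    refine Finset.prod_congr rfl fun i _ => ?_
    rw [map_sum]
    refine Finset.sum_congr rfl fun k _ => ?_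
    rw [map_pow, Polynomial.coeToPowerSeries.ringHom_apply, Polynomial.coe_X]
  have hmon : ∀ i, (∑ k ∈ Finset.range (e i), Polynomial.X ^ k : Polynomial ℤ).Monic :=
    fun i => Polynomial.monic_geom_sum_X (by have := he i; omega)
  have hdeg : ∀ i, (∑ k ∈ Finset.range (e i), Polynomial.X ^ k : Polynomial ℤ).natDegree
      = e i - 1 := by
    intro i
    have h := congrArg Polynomial.natDegree (geom_sum_mul (Polynomial.X : Polynomial ℤ) (e i))
    rw [← Polynomial.C_1, (hmon i).natDegree_mul (Polynomial.monic_X_sub_C 1),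
      Polynomial.natDegree_X_sub_C, Polynomial.natDegree_X_pow_sub_C] at h
    omega
  have h5 : (∏ i, ∑ k ∈ Finset.range (e i), Polynomial.X ^ k : Polynomial ℤ).natDegree
      = ∑ i, (e i - 1) := by
    rw [Polynomial.natDegree_prod_of_monic _ _ fun i _ => hmon i]
    exact Finset.sum_congr rfl fun i _ => hdeg i
  have h6 : (∏ i, ∑ k ∈ Finset.range (e i), Polynomial.X ^ k : Polynomial ℤ).coeff
      (∑ i, (e i - 1)) = 1 := by
    rw [← h5]
    exact Polynomial.monic_prod_of_monic _ _ fun i _ => hmon i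
  have h7 := congrArg (PowerSeries.coeff (∑ i, (e i - 1))) h1
  rw [h4, Polynomial.coeff_coe, h6, hilbertSeries, PowerSeries.coeff_mk] at h7
  have h8 : gradedPart (Ideal.span (Set.range f)) (∑ i, (e i - 1))
      = homogeneousSubmodule (Fin n) ℂ (∑ i, (e i - 1)) := inf_eq_right.2 fun a ha => htop a ha
  rw [h8, sub_self] at h7
  exact zero_ne_one h7

end Hilbert

section LinearForms

variable {n : ℕ}

/-- Derivations of the polynomial ring in `n` variables. -/
abbrev Der (n : ℕ) : Type :=
  Derivation ℂ (MvPolynomial (Fin n) ℂ) (MvPolynomial (Fin n) ℂ)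

theorem linearForm_eq {f : MvPolynomial (Fin n) ℂ} (hf : f.IsHomogeneous 1) :
    f = ∑ i, C (coeff (Finsupp.single i 1) f) * X i := by
  have h : f ∈ Submodule.span ℂ (Set.range (X : Fin n → MvPolynomial (Fin n) ℂ)) := by
    rw [← homogeneousSubmodule_one_eq_span_X]
    exact hf
  obtain ⟨c, hc⟩ := (Submodule.mem_span_range_iff_exists_fun ℂ).1 h
  have : ∀ i, coeff (Finsupp.single i 1) f = c i := by
    intro i
    classical
    rw [← hc, coeff_sum]
    simp [coeff_X, Finsupp.single_left_inj]
  rw [Finset.sum_congr rfl fun i _ => by rw [this i, ← smul_eq_C_mul], hc]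

theorem toLin_apply (f : MvPolynomial (Fin n) ℂ) (x : Fin n → ℂ) :
    toLin f x = ∑ i, coeff (Finsupp.single i 1) f * x i := by
  simp [toLin, LinearMap.sum_apply]

theorem eval_linearForm {f : MvPolynomial (Fin n) ℂ} (hf : f.IsHomogeneous 1) (x : Fin n → ℂ) :
    eval x f = toLin f x := by
  conv_lhs => rw [linearForm_eq hf]
  rw [toLin_apply, map_sum]
  simp

theorem derivation_linearForm {f : MvPolynomial (Fin n) ℂ} (hf : f.IsHomogeneous 1) (δ : Der n) :
    δ f = ∑ i, C (coeff (Finsupp.single i 1) f) * δ (X i) := by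
  conv_lhs => rw [linearForm_eq hf]
  rw [map_sum]
  refine Finset.sum_congr rfl fun i _ => ?_
  rw [← smul_eq_C_mul, δ.map_smul, smul_eq_C_mul]

theorem derivation_sum_apply {ι : Type*} (s : Finset ι) (δ : ι → Der n)
    (g : MvPolynomial (Fin n) ℂ) : (∑ k ∈ s, δ k) g = ∑ k ∈ s, δ k g := by
  have := map_sum (Derivation.coeFnAddMonoidHom (R := ℂ) (A := MvPolynomial (Fin n) ℂ)
    (M := MvPolynomial (Fin n) ℂ)) δ s
  have := congrFun this g
  rwa [Finset.sum_apply] at this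

theorem derivation_apply (δ : Der n) (g : MvPolynomial (Fin n) ℂ) :
    δ g = ∑ i, δ (X i) * pderiv i g := by
  have : δ = ∑ i, δ (X i) • (pderiv i : Der n) := by
    refine derivation_ext fun j => ?_
    rw [derivation_sum_apply]
    classical
    simp [pderiv_X, Pi.single_apply]
  conv_lhs => rw [this]
  simp [derivation_sum_apply]

/-- A derivation whose coefficients are homogeneous of degree `d`. -/
def IsHomDer (δ : Der n) (d : ℕ) : Prop :=
  ∀ i, (δ (X i)).IsHomogeneous d

theorem IsHomDer.linearForm {δ : Der n} {d : ℕ} (hδ : IsHomDer δ d) {f : MvPolynomial (Fin n) ℂ}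
    (hf : f.IsHomogeneous 1) : (δ f).IsHomogeneous d := by
  rw [derivation_linearForm hf]
  refine IsHomogeneous.sum _ _ _ fun i _ => ?_
  have := (isHomogeneous_C (Fin n) (coeff (Finsupp.single i 1) f)).mul (hδ i)
  rwa [zero_add] at this

theorem IsHomDer.apply {δ : Der n} {d : ℕ} (hδ : IsHomDer δ (d + 1)) {w : ℕ}
    {g : MvPolynomial (Fin n) ℂ} (hg : g.IsHomogeneous w) : (δ g).IsHomogeneous (w + d) := by
  rw [derivation_apply]
  refine IsHomogeneous.sum _ _ _ fun i _ => ?_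
  rcases Nat.eq_zero_or_pos w with rfl | hw
  · have : g = C (coeff 0 g) := by
      have := homogeneousComponent_of_mem (m := 0) ((mem_homogeneousSubmodule _ _).2 hg)
      rwa [if_pos rfl, homogeneousComponent_zero, eq_comm] at this
    rw [this, pderiv_C, mul_zero]
    exact isHomogeneous_zero _ _ _
  · have := (hδ i).mul (hg.pderiv (i := i))
    rwa [show d + 1 + (w - 1) = w + d by omega] at this

/-- The homogeneous components of a derivation. -/
noncomputable def homDer (d : ℕ) (δ : Der n) : Der n :=
  mkDerivation ℂ fun i => homogeneousComponent d (δ (X i))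

@[simp]
theorem homDer_X (d : ℕ) (δ : Der n) (i : Fin n) :
    homDer d δ (X i) = homogeneousComponent d (δ (X i)) :=
  mkDerivation_X _ _ _

theorem isHomDer_homDer (d : ℕ) (δ : Der n) : IsHomDer (homDer d δ) d := fun i => by
  rw [homDer_X]
  exact homogeneousComponent_isHomogeneous _ _

theorem homDer_linearForm (d : ℕ) (δ : Der n) {f : MvPolynomial (Fin n) ℂ}
    (hf : f.IsHomogeneous 1) : homDer d δ f = homogeneousComponent d (δ f) := by
  rw [derivation_linearForm hf, derivation_linearForm hf, map_sum]
  refine Finset.sum_congr rfl fun i _ => ?_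
  rw [homogeneousComponent_C_mul, homDer_X]

theorem homDer_of_isHomDer {δ : Der n} {d : ℕ} (hδ : IsHomDer δ d) (m : ℕ) :
    homDer m δ = if m = d then δ else 0 := by
  refine derivation_ext fun i => ?_
  rw [homDer_X, homogeneousComponent_of_mem (m := m) ((mem_homogeneousSubmodule _ _).2 (hδ i))]
  split_ifs <;> rfl

theorem homDer_add (d : ℕ) (δ δ' : Der n) : homDer d (δ + δ') = homDer d δ + homDer d δ' :=
  derivation_ext fun i => by simp

theorem homDer_sum {ι : Type*} (s : Finset ι) (d : ℕ) (δ : ι → Der n) :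
    homDer d (∑ k ∈ s, δ k) = ∑ k ∈ s, homDer d (δ k) :=
  derivation_ext fun i => by simp [derivation_sum_apply]

theorem homDer_C_smul (d : ℕ) (c : ℂ) (δ : Der n) :
    homDer d ((C c : MvPolynomial (Fin n) ℂ) • δ) = (C c : MvPolynomial (Fin n) ℂ) • homDer d δ :=
  derivation_ext fun i => by simp [homogeneousComponent_C_mul]

theorem homDer_X_smul (d : ℕ) (k : Fin n) (δ : Der n) :
    homDer (d + 1) ((X k : MvPolynomial (Fin n) ℂ) • δ)
      = (X k : MvPolynomial (Fin n) ℂ) • homDer d δ :=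
  derivation_ext fun i => by
    simp [homogeneousComponent_mul_of_le (isHomogeneous_X ℂ k) (Nat.le_add_left 1 d)]

theorem homDer_zero_X_smul (k : Fin n) (δ : Der n) :
    homDer 0 ((X k : MvPolynomial (Fin n) ℂ) • δ) = 0 :=
  derivation_ext fun i => by
    simp [homogeneousComponent_mul_of_lt (isHomogeneous_X ℂ k) Nat.zero_lt_one]

theorem exists_sum_homDer (δ : Der n) : ∃ N, δ = ∑ d ∈ Finset.range N, homDer d δ := by
  refine ⟨(∑ i, (δ (X i)).totalDegree) + 1, derivation_ext fun i => ?_⟩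
  rw [derivation_sum_apply]
  simp only [homDer_X]
  conv_lhs => rw [← sum_homogeneousComponent (δ (X i))]
  refine Finset.sum_subset ?_ fun d _ hd => homogeneousComponent_eq_zero _ _ ?_
  · rw [Finset.range_subset_range]
    exact Nat.add_le_add_right
      (Finset.single_le_sum (f := fun i => (δ (X i)).totalDegree) (fun _ _ => Nat.zero_le _)
        (Finset.mem_univ i)) 1
  · have := Finset.mem_range.not.1 hd
    omega

/-- The Euler derivation. -/
noncomputable def eulerDer (n : ℕ) : Der n :=
  mkDerivation ℂ X

@[simp]
theorem eulerDer_X (i : Fin n) : eulerDer n (X i) = X i :=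
  mkDerivation_X _ _ _

theorem eulerDer_apply {g : MvPolynomial (Fin n) ℂ} {w : ℕ} (hg : g.IsHomogeneous w) :
    eulerDer n g = w • g := by
  rw [derivation_apply, ← hg.sum_X_mul_pderiv]
  simp

theorem isHomDer_eulerDer : IsHomDer (eulerDer n) 1 := fun i => by
  rw [eulerDer_X]
  exact isHomogeneous_X _ _

variable {p : ℕ} {l : Fin p → MvPolynomial (Fin n) ℂ}

theorem mem_DA {χ : Der n} : χ ∈ DA l ↔ ∀ i, l i ∣ χ (l i) := by
  simp only [← Ideal.mem_span_singleton]
  rfl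

theorem eulerDer_mem_DA (hlh : ∀ i, (l i).IsHomogeneous 1) : eulerDer n ∈ DA l :=
  mem_DA.2 fun i => by rw [eulerDer_apply (hlh i), one_smul]

theorem homDer_mem_DA (hlh : ∀ i, (l i).IsHomogeneous 1) {χ : Der n} (hχ : χ ∈ DA l) (d : ℕ) :
    homDer d χ ∈ DA l := by
  refine mem_DA.2 fun i => ?_
  obtain ⟨a, ha⟩ := mem_DA.1 hχ i
  rw [homDer_linearForm d χ (hlh i), ha]
  rcases Nat.eq_zero_or_pos d with rfl | hd
  · rw [homogeneousComponent_mul_of_lt (hlh i) Nat.zero_lt_one]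
    exact dvd_zero _
  · rw [homogeneousComponent_mul_of_le (hlh i) hd]
    exact dvd_mul_right _ _

theorem constantCoeff_apply_X_of_mem_DA (hlh : ∀ i, (l i).IsHomogeneous 1)
    (hess : (⨅ i, hyp l i) = ⊥) {χ : Der n} (hχ : χ ∈ DA l) (j : Fin n) :
    constantCoeff (χ (X j)) = 0 := by
  have h : (fun j => constantCoeff (χ (X j))) ∈ ⨅ i, hyp l i := by
    rw [Submodule.mem_iInf]
    intro i
    obtain ⟨a, ha⟩ := mem_DA.1 hχ i
    have h1 := congrArg constantCoeff ha
    have h2 : constantCoeff (l i) = 0 := (hlh i).coeff_eq_zero (d := 0) (by simp)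
    rw [derivation_linearForm (hlh i), map_mul, h2, zero_mul, map_sum] at h1
    simp only [map_mul, constantCoeff_C] at h1
    rw [hyp, LinearMap.mem_ker, toLin_apply, h1]
  rw [hess, Submodule.mem_bot] at h
  exact congrFun h j

end LinearForms

section Generators

variable {n p : ℕ} {l : Fin p → MvPolynomial (Fin n) ℂ}

/-- The coefficient vector of a derivation. -/
noncomputable def coeffVec (n : ℕ) :
    Der n →ₗ[MvPolynomial (Fin n) ℂ] (Fin n → MvPolynomial (Fin n) ℂ) where
  toFun δ i := δ (X i)
  map_add' _ _ := rfl
  map_smul' _ _ := rfl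

theorem coeffVec_injective : Function.Injective (coeffVec n) :=
  fun _ _ h => derivation_ext fun i => congrFun h i

theorem prod_smul_mem_DA (χ : Der n) : (∏ i, l i) • χ ∈ DA l :=
  mem_DA.2 fun i => Dvd.dvd.mul_right (Finset.dvd_prod_of_mem l (Finset.mem_univ i)) _

instance finite_DA : Module.Finite (MvPolynomial (Fin n) ℂ) (DA l) :=
  Module.Finite.of_injective ((coeffVec n).comp (DA l).subtype)
    (coeffVec_injective.comp (DA l).injective_subtype)

theorem finrank_DA (hl0 : ∀ i, l i ≠ 0) : Module.finrank (MvPolynomial (Fin n) ℂ) (DA l) = n := by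
  apply le_antisymm
  · have := LinearMap.finrank_le_finrank_of_injective
      (f := (coeffVec n).comp (DA l).subtype) (coeffVec_injective.comp (DA l).injective_subtype)
    simpa using this
  · let φ : (Fin n → MvPolynomial (Fin n) ℂ) →ₗ[MvPolynomial (Fin n) ℂ] DA l :=
      { toFun v := ⟨(∏ i, l i) • mkDerivation ℂ v, prod_smul_mem_DA _⟩
        map_add' u v := Subtype.ext (derivation_ext fun i => by simp [mul_add])
        map_smul' r v := Subtype.ext (derivation_ext fun i => by simp [mul_left_comm]) }
    have hφ : Function.Injective φ := by
      intro u v h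
      funext i
      have := congrArg (fun χ : DA l => χ.1 (X i)) h
      have h2 : (∏ i, l i) * u i = (∏ i, l i) * v i := by simpa [φ] using this
      exact mul_left_cancel₀ (Finset.prod_ne_zero_iff.2 fun i _ => hl0 i) h2
    have := LinearMap.finrank_le_finrank_of_injective hφ
    simpa using this

theorem constantCoeff_sum_mul_eq_zero (r : Fin n → MvPolynomial (Fin n) ℂ) :
    (∀ i, constantCoeff (r i) = 0) → ∀ f : Fin n → MvPolynomial (Fin n) ℂ,
    (∀ i, constantCoeff (f i) = 0) → ∀ j, ∑ i, r i * f i ≠ X j := by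
  intro hr f hf j h
  have := congrArg (fun q => constantCoeff (pderiv j q)) h
  simp only [map_sum, Derivation.leibniz, map_add, smul_eq_mul, map_mul, hr, hf, zero_mul,
    add_zero, Finset.sum_const_zero, pderiv_X_self, map_one] at this
  exact zero_ne_one this

/-- The fibre at the origin of a free module of derivations. -/
noncomputable def fibre (B : Module.Basis (Fin n) (MvPolynomial (Fin n) ℂ) (DA l)) :
    DA l →+ (Fin n → ℂ) where
  toFun χ i := constantCoeff (B.repr χ i)
  map_zero' := by ext; simp
  map_add' _ _ := by ext; simp

theorem fibre_smul (B : Module.Basis (Fin n) (MvPolynomial (Fin n) ℂ) (DA l))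
    (r : MvPolynomial (Fin n) ℂ) (χ : DA l) : fibre B (r • χ) = constantCoeff r • fibre B χ := by
  ext i
  simp [fibre]

theorem exists_sum_X_smul_of_fibre_eq_zero
    (B : Module.Basis (Fin n) (MvPolynomial (Fin n) ℂ) (DA l)) {χ : DA l} (h : fibre B χ = 0) :
    ∃ η : Fin n → DA l, χ = ∑ k, (X k : MvPolynomial (Fin n) ℂ) • η k := by
  have : ∀ i, ∃ s : Fin n → MvPolynomial (Fin n) ℂ, ∑ k, s k * X k = B.repr χ i := by
    intro i
    have hi : constantCoeff (B.repr χ i) = 0 := congrFun h i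
    have hmem : B.repr χ i ∈ Ideal.span (Set.range (X : Fin n → MvPolynomial (Fin n) ℂ)) := by
      rw [← Set.image_univ, mem_ideal_span_X_image]
      intro m hm
      by_contra! h
      have : m = 0 := by ext i; exact h i (Set.mem_univ i)
      subst this
      exact mem_support_iff.1 hm hi
    obtain ⟨s, hs⟩ := (Submodule.mem_span_range_iff_exists_fun _).1 hmem
    exact ⟨s, by simpa using hs⟩
  choose s hs using this
  refine ⟨fun k => ∑ i, s i k • B i, ?_⟩
  simp only [Finset.smul_sum, smul_smul]
  rw [Finset.sum_comm]
  conv_lhs => rw [← B.sum_repr χ]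
  refine Finset.sum_congr rfl fun i _ => ?_
  rw [← hs i, Finset.sum_smul]
  exact Finset.sum_congr rfl fun k _ => by rw [mul_comm]

theorem fibre_eulerDer_ne_zero (hn : 0 < n) (hlh : ∀ i, (l i).IsHomogeneous 1)
    (hess : (⨅ i, hyp l i) = ⊥) (B : Module.Basis (Fin n) (MvPolynomial (Fin n) ℂ) (DA l)) :
    fibre B ⟨eulerDer n, eulerDer_mem_DA hlh⟩ ≠ 0 := by
  intro h
  obtain ⟨η, hη⟩ := exists_sum_X_smul_of_fibre_eq_zero B h
  have h1 := congrArg Subtype.val hη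
  have h2 := congrArg (fun δ : Der n => δ (X ⟨0, hn⟩)) h1
  simp only [eulerDer_X, Submodule.coe_sum, derivation_sum_apply] at h2
  exact constantCoeff_sum_mul_eq_zero (fun k => X k) (by simp) (fun k => (η k).1 (X ⟨0, hn⟩))
    (fun k => constantCoeff_apply_X_of_mem_DA hlh hess (η k).2 _) _ h2.symm

theorem span_fibre_eq_top (hlh : ∀ i, (l i).IsHomogeneous 1)
    (B : Module.Basis (Fin n) (MvPolynomial (Fin n) ℂ) (DA l)) :
    ⊤ ≤ Submodule.span ℂ {v | ∃ (χ : DA l) (d : ℕ), IsHomDer χ.1 d ∧ fibre B χ = v} := by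
  intro v _
  have hv : fibre B (∑ i, (C (v i) : MvPolynomial (Fin n) ℂ) • B i) = v := by
    rw [map_sum]
    ext j
    rw [Finset.sum_apply]
    simp [fibre, Finsupp.single_apply, apply_ite]
  set χ := ∑ i, (C (v i) : MvPolynomial (Fin n) ℂ) • B i
  obtain ⟨N, hN⟩ := exists_sum_homDer χ.1
  have hχ : χ = ∑ d ∈ Finset.range N, ⟨homDer d χ.1, homDer_mem_DA hlh χ.2 d⟩ := by
    apply Subtype.ext
    have hsum := Submodule.coe_sum (DA l)
      (fun d => ⟨homDer d χ.1, homDer_mem_DA hlh χ.2 d⟩) (Finset.range N)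
    exact hN.trans hsum.symm
  rw [← hv, hχ, map_sum]
  exact Submodule.sum_mem _ fun d _ => Submodule.subset_span ⟨_, d, isHomDer_homDer _ _, rfl⟩

/-- Homogeneous elements whose fibres span the fibre generate the module. -/
theorem mem_span_of_fibre_basis (hlh : ∀ i, (l i).IsHomogeneous 1)
    (B : Module.Basis (Fin n) (MvPolynomial (Fin n) ℂ) (DA l)) (δ : Fin n → DA l) (d : Fin n → ℕ)
    (hδ : ∀ i, IsHomDer (δ i).1 (d i))
    (b : Module.Basis (Fin n) ℂ (Fin n → ℂ)) (hb : ∀ i, b i = fibre B (δ i)) (χ : Der n)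
    (hχ : χ ∈ DA l) :
    χ ∈ Submodule.span (MvPolynomial (Fin n) ℂ) (Set.range fun i => (δ i).1) := by
  have key : ∀ m, ∀ χ ∈ DA l, IsHomDer χ m →
      χ ∈ Submodule.span (MvPolynomial (Fin n) ℂ) (Set.range fun i => (δ i).1) := by
    intro m
    induction m using Nat.strong_induction_on with
    | _ m ih =>
    intro χ hχ hm
    set c := b.repr (fibre B ⟨χ, hχ⟩)
    have h0 : fibre B (⟨χ, hχ⟩ - ∑ i, (C (c i) : MvPolynomial (Fin n) ℂ) • δ i) = 0 := by
      rw [(fibre B).map_sub, map_sum, sub_eq_zero]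
      conv_lhs => rw [← b.sum_repr (fibre B ⟨χ, hχ⟩)]
      exact Finset.sum_congr rfl fun i _ => by rw [fibre_smul, hb, constantCoeff_C]
    obtain ⟨η, hη⟩ := exists_sum_X_smul_of_fibre_eq_zero B h0
    have h1 := congrArg Subtype.val hη
    simp only [Submodule.coe_sub, Submodule.coe_sum, Submodule.coe_smul] at h1
    rw [sub_eq_iff_eq_add] at h1
    have h2 := congrArg (homDer m) h1
    rw [homDer_of_isHomDer hm, if_pos rfl, homDer_add, homDer_sum, homDer_sum] at h2
    rw [h2]
    refine Submodule.add_mem _ (Submodule.sum_mem _ fun k _ => ?_)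
      (Submodule.sum_mem _ fun i _ => ?_)
    · cases m with
      | zero => rw [homDer_zero_X_smul]; exact Submodule.zero_mem _
      | succ m =>
        rw [homDer_X_smul]
        exact Submodule.smul_mem _ _ (ih m (Nat.lt_succ_self m) _ (homDer_mem_DA hlh (η k).2 m)
          (isHomDer_homDer _ _))
    · rw [homDer_C_smul, homDer_of_isHomDer (hδ i)]
      refine Submodule.smul_mem _ _ ?_
      split_ifs
      · exact Submodule.subset_span ⟨i, rfl⟩
      · exact Submodule.zero_mem _
  obtain ⟨N, hN⟩ := exists_sum_homDer χ
  rw [hN]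
  exact Submodule.sum_mem _ fun d _ => key d _ (homDer_mem_DA hlh hχ d) (isHomDer_homDer _ _)

theorem exists_homogeneous_generators (hn : 0 < n) (hl0 : ∀ i, l i ≠ 0)
    (hlh : ∀ i, (l i).IsHomogeneous 1) (hess : (⨅ i, hyp l i) = ⊥)
    (hfree : Module.Free (MvPolynomial (Fin n) ℂ) (DA l)) :
    ∃ (i₀ : Fin n) (δ : Fin n → Der n) (d : Fin n → ℕ), δ i₀ = eulerDer n ∧ d i₀ = 1 ∧
      (∀ i, IsHomDer (δ i) (d i)) ∧ (∀ i, δ i ∈ DA l) ∧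
      ∀ χ ∈ DA l, χ ∈ Submodule.span (MvPolynomial (Fin n) ℂ) (Set.range δ) := by
  let B : Module.Basis (Fin n) (MvPolynomial (Fin n) ℂ) (DA l) :=
    Module.finBasisOfFinrankEq _ _ (finrank_DA hl0)
  set E : DA l := ⟨eulerDer n, eulerDer_mem_DA hlh⟩
  have hE := fibre_eulerDer_ne_zero hn hlh hess B
  have hs : LinearIndepOn ℂ id {fibre B E} := LinearIndepOn.singleton hE
  have hst : {fibre B E} ⊆ {v | ∃ (χ : DA l) (d : ℕ), IsHomDer χ.1 d ∧ fibre B χ = v} :=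
    Set.singleton_subset_iff.2 ⟨E, 1, isHomDer_eulerDer, rfl⟩
  let b₀ := Module.Basis.extendLe hs hst (span_fibre_eq_top hlh B)
  have : Fintype (hs.extend hst) := FiniteDimensional.fintypeBasisIndex b₀
  have hcard : Fintype.card (hs.extend hst) = n := by
    rw [← Module.finrank_eq_card_basis b₀]
    simp
  let ε : (hs.extend hst) ≃ Fin n := Fintype.equivFinOfCardEq hcard
  let b := b₀.reindex ε
  have hbv : ∀ i, b i = (ε.symm i).1 := fun i => by
    rw [Module.Basis.reindex_apply, Module.Basis.extendLe_apply_self]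
  have hEmem : fibre B E ∈ hs.extend hst := hs.subset_extend hst rfl
  set i₀ := ε ⟨fibre B E, hEmem⟩
  have hch : ∀ i, ∃ (χ : DA l) (d : ℕ), IsHomDer χ.1 d ∧ fibre B χ = b i ∧
      (i = i₀ → χ = E ∧ d = 1) := by
    intro i
    by_cases hi : i = i₀
    · refine ⟨E, 1, isHomDer_eulerDer, ?_, fun _ => ⟨rfl, rfl⟩⟩
      rw [hbv, hi, Equiv.symm_apply_apply]
    · obtain ⟨χ, d, h1, h2⟩ := hs.extend_subset hst (ε.symm i).2
      exact ⟨χ, d, h1, by rw [h2, hbv], fun h => absurd h hi⟩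
  choose δ d hδ hfb hi₀ using hch
  refine ⟨i₀, fun i => (δ i).1, d, ?_, (hi₀ i₀ rfl).2, hδ, fun i => (δ i).2, fun χ hχ =>
    mem_span_of_fibre_basis hlh B δ d hδ b (fun i => (hfb i).symm) χ hχ⟩
  change (δ i₀).1 = _
  rw [(hi₀ i₀ rfl).1]

end Generators

section Generators

variable {n p : ℕ} {l : Fin p → MvPolynomial (Fin n) ℂ}

theorem det_coeff_ne_zero (hl0 : ∀ i, l i ≠ 0) {δ : Fin n → Der n}
    (hgen : ∀ χ ∈ DA l, ∃ c : Fin n → MvPolynomial (Fin n) ℂ, χ = ∑ i, c i • δ i) :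
    (Matrix.of fun i j => δ i (X j)).det ≠ 0 := by
  choose c hc using fun k : Fin n => hgen _ (prod_smul_mem_DA (l := l) (pderiv k))
  have h : Matrix.of c * (Matrix.of fun i j => δ i (X j))
      = (∏ i, l i) • (1 : Matrix (Fin n) (Fin n) (MvPolynomial (Fin n) ℂ)) := by
    ext1 k j
    have h1 := congrArg (fun χ : Der n => χ (X j)) (hc k)
    simp only [derivation_sum_apply, Derivation.coe_smul, Pi.smul_apply, smul_eq_mul] at h1
    rw [Matrix.mul_apply, Matrix.smul_apply, Matrix.one_apply, smul_eq_mul]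
    simp only [Matrix.of_apply]
    rw [← h1, pderiv_X]
    congr 1
    simp [Pi.single_apply, eq_comm]
  have h2 := congrArg Matrix.det h
  rw [Matrix.det_mul, Matrix.det_smul, Matrix.det_one, mul_one] at h2
  intro h0
  rw [h0, mul_zero] at h2
  exact pow_ne_zero _ (Finset.prod_ne_zero_iff.2 fun i _ => hl0 i) h2.symm

theorem exists_coeff_ne_zero {f : MvPolynomial (Fin n) ℂ} (hf : f.IsHomogeneous 1) (h0 : f ≠ 0) :
    ∃ i, coeff (Finsupp.single i 1) f ≠ 0 := by
  by_contra! h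
  rw [linearForm_eq hf] at h0
  simp [h] at h0

theorem dvd_det_coeff (hl0 : ∀ i, l i ≠ 0) (hlh : ∀ i, (l i).IsHomogeneous 1) {δ : Fin n → Der n}
    (hδ : ∀ i, δ i ∈ DA l) (k : Fin p) : l k ∣ (Matrix.of fun i j => δ i (X j)).det := by
  set A : Matrix (Fin n) (Fin n) (MvPolynomial (Fin n) ℂ) := Matrix.of fun i j => δ i (X j)
  let v : Fin n → MvPolynomial (Fin n) ℂ := fun i => C (coeff (Finsupp.single i 1) (l k))
  choose ψ hψ using fun i => mem_DA.1 (hδ i) k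
  have hA : A.mulVec v = fun i => l k * ψ i := by
    funext i
    rw [← hψ i, derivation_linearForm (hlh k), Matrix.mulVec, dotProduct]
    exact Finset.sum_congr rfl fun j _ => mul_comm _ _
  obtain ⟨j, hj⟩ := exists_coeff_ne_zero (hlh k) (hl0 k)
  have h := congrArg (fun w => A.adjugate.mulVec w j) hA
  simp only [Matrix.mulVec_mulVec, Matrix.adjugate_mul, Matrix.smul_mulVec, Matrix.one_mulVec,
    Pi.smul_apply, smul_eq_mul] at h
  have h1 : l k ∣ A.det * v j := by
    rw [h, Matrix.mulVec, dotProduct]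
    exact Finset.dvd_sum fun i _ => Dvd.dvd.mul_left (dvd_mul_right _ _) _
  have hu : IsUnit (v j) := (isUnit_iff_ne_zero.2 hj).map C
  exact (hu.dvd_mul_right).1 h1

theorem irreducible_linearForm {f : MvPolynomial (Fin n) ℂ} (hf : f.IsHomogeneous 1)
    (h0 : f ≠ 0) : Irreducible f := by
  refine irreducible_of_totalDegree_eq_one (hf.totalDegree h0) fun x hx => ?_
  obtain ⟨i, hi⟩ := exists_coeff_ne_zero hf h0
  exact isUnit_of_dvd_unit (hx _) (isUnit_iff_ne_zero.2 hi)

theorem isRelPrime_linearForm {f g : MvPolynomial (Fin n) ℂ} (hf : f.IsHomogeneous 1)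
    (hg : g.IsHomogeneous 1) (hf0 : f ≠ 0) (hg0 : g ≠ 0) (h : ∀ c : ℂ, g ≠ c • f) :
    IsRelPrime f g := by
  rw [(irreducible_linearForm hf hf0).isRelPrime_iff_not_dvd]
  rintro ⟨a, rfl⟩
  have ha0 : a ≠ 0 := right_ne_zero_of_mul hg0
  have h1 := hg.totalDegree hg0
  rw [totalDegree_mul_of_isDomain hf0 ha0, hf.totalDegree hf0] at h1
  have h2 : a = C (coeff 0 a) := totalDegree_eq_zero_iff_eq_C.1 (by omega)
  refine h (coeff 0 a) ?_
  rw [smul_eq_C_mul, ← h2, mul_comm]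

theorem isHomogeneous_det {A : Matrix (Fin n) (Fin n) (MvPolynomial (Fin n) ℂ)} {d : Fin n → ℕ}
    (hA : ∀ i j, (A i j).IsHomogeneous (d i)) : A.det.IsHomogeneous (∑ i, d i) := by
  rw [Matrix.det_apply]
  refine IsHomogeneous.sum _ _ _ fun σ _ => ?_
  have h : (∏ i, A (σ i) i).IsHomogeneous (∑ i, d i) := by
    rw [← Equiv.sum_comp σ d]
    exact IsHomogeneous.prod _ _ _ fun i _ => hA (σ i) i
  exact Submodule.smul_of_tower_mem (homogeneousSubmodule (Fin n) ℂ _) _ h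

theorem prod_isHomogeneous (hlh : ∀ i, (l i).IsHomogeneous 1) : (∏ i, l i).IsHomogeneous p := by
  have := IsHomogeneous.prod Finset.univ l (fun _ => 1) fun i _ => hlh i
  simpa using this

theorem card_le_sum_degree (hl0 : ∀ i, l i ≠ 0) (hlh : ∀ i, (l i).IsHomogeneous 1)
    (hprop : ∀ i j, i ≠ j → ∀ c : ℂ, l i ≠ c • l j) {δ : Fin n → Der n} {d : Fin n → ℕ}
    (hd : ∀ i, IsHomDer (δ i) (d i)) (hδ : ∀ i, δ i ∈ DA l)
    (hgen : ∀ χ ∈ DA l, ∃ c : Fin n → MvPolynomial (Fin n) ℂ, χ = ∑ i, c i • δ i) :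
    p ≤ ∑ i, d i := by
  have hdet := det_coeff_ne_zero hl0 hgen
  obtain ⟨q, hq⟩ : (∏ k, l k) ∣ (Matrix.of fun i j => δ i (X j)).det :=
    Fintype.prod_dvd_of_isRelPrime
      (fun i j hij => isRelPrime_linearForm (hlh i) (hlh j) (hl0 i) (hl0 j) (hprop j i hij.symm))
      (dvd_det_coeff hl0 hlh hδ)
  have hF0 : (∏ k, l k) ≠ 0 := Finset.prod_ne_zero_iff.2 fun i _ => hl0 i
  have h1 := (isHomogeneous_det (A := Matrix.of fun i j => δ i (X j)) (d := d)
    fun i j => hd i j).totalDegree hdet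
  have hq0 : q ≠ 0 := by
    rintro rfl
    exact hdet (by rw [hq, mul_zero])
  rw [hq, totalDegree_mul_of_isDomain hF0 hq0, (prod_isHomogeneous hlh).totalDegree hF0] at h1
  omega

/-- For an irreducible essential arrangement, a logarithmic derivation with linear coefficients
that annihilates one of the forms is zero. -/
theorem eq_zero_of_isHomDer_one (hlh : ∀ i, (l i).IsHomogeneous 1)
    (hirr : IrredOn l Finset.univ) (hess : (⨅ i, hyp l i) = ⊥) {χ : Der n} (hχ : χ ∈ DA l)
    (hd : IsHomDer χ 1) {k₀ : Fin p} (hl0 : ∀ i, l i ≠ 0) (hk₀ : χ (l k₀) = 0) : χ = 0 := by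
  by_contra hne
  choose ψ hψ using fun k => mem_DA.1 hχ k
  let L : (Fin n → ℂ) →ₗ[ℂ] (Fin n → ℂ) := LinearMap.pi fun j => toLin (χ (X j))
  have hmem : ∀ x : Fin n → ℂ, (∀ k, toLin (l k) x = 0) → x = 0 := by
    intro x hx
    have : x ∈ ⨅ i, hyp l i := (Submodule.mem_iInf _).2 fun k => hx k
    rwa [hess] at this
  have hL : ∀ k x, toLin (l k) (L x) = eval x (χ (l k)) := by
    intro k x
    rw [derivation_linearForm (hlh k), toLin_apply, map_sum]
    refine Finset.sum_congr rfl fun j _ => ?_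
    rw [map_mul, eval_C, eval_linearForm (hd j)]
    rfl
  have hc : ∀ k, ∃ c : ℂ, χ (l k) = c • l k := by
    intro k
    by_cases h0 : χ (l k) = 0
    · exact ⟨0, by rw [h0, zero_smul]⟩
    · have h1 := (hd.linearForm (hlh k)).totalDegree h0
      have hψ0 : ψ k ≠ 0 := by
        intro h; exact h0 (by rw [hψ, h, mul_zero])
      rw [hψ, totalDegree_mul_of_isDomain (hl0 k) hψ0, (hlh k).totalDegree (hl0 k)] at h1
      have h2 : ψ k = C (coeff 0 (ψ k)) := totalDegree_eq_zero_iff_eq_C.1 (by omega)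
      exact ⟨coeff 0 (ψ k), by rw [smul_eq_C_mul, ← h2, mul_comm, ← hψ]⟩
  choose c hc using hc
  have hLc : ∀ k x, toLin (l k) (L x) = c k * toLin (l k) x := by
    intro k x
    rw [hL, hc, smul_eval, eval_linearForm (hlh k)]
  have hc0 : c k₀ = 0 := by
    have := hc k₀
    rw [hk₀] at this
    exact (smul_eq_zero.1 this.symm).resolve_right (hl0 k₀)
  obtain ⟨k₁, hk₁⟩ : ∃ k, c k ≠ 0 := by
    by_contra! h
    apply hne
    refine derivation_ext fun j => ?_
    rw [Derivation.coe_zero, Pi.zero_apply]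
    apply MvPolynomial.funext
    intro x
    have : L x = 0 := hmem _ fun k => by rw [hLc, h, zero_mul]
    rw [eval_linearForm (hd j), map_zero]
    exact congrFun this j
  have hker : ∀ k, c k ≠ 0 → LinearMap.ker L ≤ hyp l k := by
    intro k hk x hx
    have := hLc k x
    rw [LinearMap.mem_ker.1 hx, map_zero] at this
    exact (mul_eq_zero.1 this.symm).resolve_left hk
  have hrange : ∀ k, c k = 0 → LinearMap.range L ≤ hyp l k := by
    rintro k hk _ ⟨x, rfl⟩
    have := hLc k x
    rwa [hk, zero_mul] at this
  have hdisj : Disjoint (LinearMap.ker L) (LinearMap.range L) := by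
    rw [Submodule.disjoint_def]
    intro x hx hx'
    refine hmem x fun k => ?_
    by_cases hk : c k = 0
    · exact hrange k hk hx'
    · exact hker k hk hx
  refine hirr ⟨LinearMap.ker L, LinearMap.range L, ?_, fun k _ => ?_, ⟨k₁, Finset.mem_univ _,
    hker k₁ hk₁⟩, ⟨k₀, Finset.mem_univ _, hrange k₀ hc0⟩⟩
  · refine ⟨hdisj, codisjoint_iff.2 ?_⟩
    apply Submodule.eq_top_of_disjoint _ _ _ hdisj
    rw [add_comm, LinearMap.finrank_range_add_finrank_ker]
  · by_cases hk : c k = 0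
    · exact Or.inr (hrange k hk)
    · exact Or.inl (hker k hk)

/-- Normalized homogeneous generators of the module of logarithmic derivations. -/
structure IsNormalizedGen (l : Fin p → MvPolynomial (Fin n) ℂ) (k₀ : Fin p) (i₀ : Fin n)
    (δ : Fin n → Der n) (d : Fin n → ℕ) : Prop where
  euler : δ i₀ = eulerDer n
  degree_euler : d i₀ = 1
  hom : ∀ i, IsHomDer (δ i) (d i)
  mem : ∀ i, δ i ∈ DA l
  gen : ∀ χ ∈ DA l, ∃ c : Fin n → MvPolynomial (Fin n) ℂ, χ = ∑ i, c i • δ i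
  annihilates : ∀ i, i ≠ i₀ → δ i (l k₀) = 0
  two_le : ∀ i, i ≠ i₀ → 2 ≤ d i
  card_le : p ≤ ∑ i, d i

theorem exists_isNormalizedGen (k₀ : Fin p) (hl0 : ∀ i, l i ≠ 0)
    (hlh : ∀ i, (l i).IsHomogeneous 1)
    (hprop : ∀ i j, i ≠ j → ∀ c : ℂ, l i ≠ c • l j)
    (hfree : Module.Free (MvPolynomial (Fin n) ℂ) (DA l))
    (hirr : IrredOn l Finset.univ) (hess : (⨅ i, hyp l i) = ⊥) :
    ∃ i₀ δ d, IsNormalizedGen l k₀ i₀ δ d := by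
  have hn : 0 < n := by
    obtain ⟨i, -⟩ := exists_coeff_ne_zero (hlh k₀) (hl0 k₀)
    exact i.pos
  obtain ⟨i₀, δ, d, hE, hd₀, hhom, hmem, hgen⟩ :=
    exists_homogeneous_generators hn hl0 hlh hess hfree
  have hgen' : ∀ χ ∈ DA l, ∃ c : Fin n → MvPolynomial (Fin n) ℂ, χ = ∑ i, c i • δ i := by
    intro χ hχ
    obtain ⟨c, hc⟩ := (Submodule.mem_span_range_iff_exists_fun _).1 (hgen χ hχ)
    exact ⟨c, hc.symm⟩
  have hdpos : ∀ δ : Der n, δ ∈ DA l → IsHomDer δ 0 → δ = 0 := by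
    intro δ hδ h0
    refine derivation_ext fun j => ?_
    have h1 := constantCoeff_apply_X_of_mem_DA hlh hess hδ j
    have h2 := homogeneousComponent_of_mem (m := 0) ((mem_homogeneousSubmodule _ _).2 (h0 j))
    have h3 : coeff 0 (δ (X j)) = 0 := h1
    rw [if_pos rfl, homogeneousComponent_zero, h3, C_0] at h2
    exact h2.symm
  have hne : ∀ (δ : Fin n → Der n) (_ : ∀ χ ∈ DA l, ∃ c : Fin n → MvPolynomial (Fin n) ℂ,
      χ = ∑ i, c i • δ i) i, δ i ≠ 0 := by
    intro δ hgen i hi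
    refine det_coeff_ne_zero hl0 hgen (Matrix.det_eq_zero_of_row_eq_zero i fun j => ?_)
    simp [hi]
  have hd1 : ∀ i, 1 ≤ d i := by
    intro i
    by_contra! h
    refine hne δ hgen' i (hdpos _ (hmem i) ?_)
    have := hhom i
    rwa [show d i = 0 by omega] at this
  choose ψ hψ using fun i => mem_DA.1 (hmem i) k₀
  have hψhom : ∀ i, (ψ i).IsHomogeneous (d i - 1) := by
    intro i
    have h1 := (hhom i).linearForm (hlh k₀)
    have h2 := homogeneousComponent_of_mem (m := d i) ((mem_homogeneousSubmodule _ _).2 h1)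
    rw [if_pos rfl, hψ, homogeneousComponent_mul_of_le (hlh k₀) (hd1 i)] at h2
    rw [← mul_left_cancel₀ (hl0 k₀) h2]
    exact homogeneousComponent_isHomogeneous _ _
  let δ' : Fin n → Der n := fun i => if i = i₀ then eulerDer n else δ i - ψ i • eulerDer n
  have hδ'₀ : δ' i₀ = eulerDer n := if_pos rfl
  have hδ' : ∀ i, i ≠ i₀ → δ' i = δ i - ψ i • eulerDer n := fun i hi => if_neg hi
  have hhom' : ∀ i, IsHomDer (δ' i) (d i) := by
    intro i
    by_cases hi : i = i₀
    · rw [hi, hδ'₀, hd₀]; exact isHomDer_eulerDer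
    · intro j
      rw [hδ' i hi]
      simp only [Derivation.sub_apply, Derivation.smul_apply, eulerDer_X, smul_eq_mul]
      refine (hhom i j).sub ?_
      have := (hψhom i).mul (isHomogeneous_X ℂ j)
      rwa [Nat.sub_add_cancel (hd1 i)] at this
  have hmem' : ∀ i, δ' i ∈ DA l := by
    intro i
    by_cases hi : i = i₀
    · rw [hi, hδ'₀]; exact eulerDer_mem_DA hlh
    · rw [hδ' i hi]
      exact Submodule.sub_mem _ (hmem i) (Submodule.smul_mem _ _ (eulerDer_mem_DA hlh))
  have hsp : ∀ i, δ i ∈ Submodule.span (MvPolynomial (Fin n) ℂ) (Set.range δ') := by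
    intro i
    have hEs : eulerDer n ∈ Submodule.span (MvPolynomial (Fin n) ℂ) (Set.range δ') := by
      rw [← hδ'₀]; exact Submodule.subset_span ⟨i₀, rfl⟩
    by_cases hi : i = i₀
    · rw [hi, hE]; exact hEs
    · have : δ i = δ' i + ψ i • eulerDer n := by rw [hδ' i hi, sub_add_cancel]
      rw [this]
      exact Submodule.add_mem _ (Submodule.subset_span ⟨i, rfl⟩) (Submodule.smul_mem _ _ hEs)
  have hgen'' : ∀ χ ∈ DA l, ∃ c : Fin n → MvPolynomial (Fin n) ℂ, χ = ∑ i, c i • δ' i := by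
    intro χ hχ
    have : Submodule.span (MvPolynomial (Fin n) ℂ) (Set.range δ)
        ≤ Submodule.span (MvPolynomial (Fin n) ℂ) (Set.range δ') := by
      rw [Submodule.span_le]
      rintro _ ⟨i, rfl⟩
      exact hsp i
    obtain ⟨c, hc⟩ := (Submodule.mem_span_range_iff_exists_fun _).1 (this (hgen χ hχ))
    exact ⟨c, hc.symm⟩
  have hann : ∀ i, i ≠ i₀ → δ' i (l k₀) = 0 := by
    intro i hi
    rw [hδ' i hi, Derivation.sub_apply, Derivation.smul_apply, eulerDer_apply (hlh k₀), one_smul,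
      hψ, smul_eq_mul, mul_comm, sub_self]
  refine ⟨i₀, δ', d, hδ'₀, hd₀, hhom', hmem', hgen'', hann, fun i hi => ?_,
    card_le_sum_degree hl0 hlh hprop hhom' hmem' hgen''⟩
  by_contra! h
  have h1 : d i = 1 := by have := hd1 i; omega
  refine hne δ' hgen'' i (eq_zero_of_isHomDer_one hlh hirr hess (hmem' i) ?_ hl0 (hann i hi))
  rw [← h1]
  exact hhom' i

end Generators

section LogPart

variable {n p : ℕ} {l : Fin p → MvPolynomial (Fin n) ℂ}

open Classical in
/-- The quotient `χ (l k) / l k` for a logarithmic derivation `χ`. -/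
noncomputable def logPart (l : Fin p → MvPolynomial (Fin n) ℂ) (χ : Der n) (k : Fin p) :
    MvPolynomial (Fin n) ℂ :=
  if h : l k ∣ χ (l k) then h.choose else 0

theorem apply_eq_mul_logPart {χ : Der n} (hχ : χ ∈ DA l) (k : Fin p) :
    χ (l k) = l k * logPart l χ k := by
  have h := mem_DA.1 hχ k
  rw [logPart, dif_pos h]
  exact h.choose_spec

theorem logPart_eq (hl0 : ∀ i, l i ≠ 0) {χ : Der n} {k : Fin p} {a : MvPolynomial (Fin n) ℂ}
    (ha : χ (l k) = l k * a) : logPart l χ k = a := by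
  have h : l k ∣ χ (l k) := ⟨a, ha⟩
  have h2 : logPart l χ k = h.choose := dif_pos h
  rw [h2]
  exact mul_left_cancel₀ (hl0 k) (h.choose_spec.symm.trans ha)

theorem logPart_smul (hl0 : ∀ i, l i ≠ 0) {χ : Der n} (hχ : χ ∈ DA l)
    (c : MvPolynomial (Fin n) ℂ) (k : Fin p) : logPart l (c • χ) k = c * logPart l χ k := by
  refine logPart_eq hl0 ?_
  rw [Derivation.coe_smul, Pi.smul_apply, smul_eq_mul, apply_eq_mul_logPart hχ]
  ring

theorem logPart_sum (hl0 : ∀ i, l i ≠ 0) {ι : Type*} (s : Finset ι) {χ : ι → Der n}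
    (hχ : ∀ i, χ i ∈ DA l) (k : Fin p) :
    logPart l (∑ i ∈ s, χ i) k = ∑ i ∈ s, logPart l (χ i) k := by
  refine logPart_eq hl0 ?_
  rw [derivation_sum_apply, Finset.mul_sum]
  exact Finset.sum_congr rfl fun i _ => apply_eq_mul_logPart (hχ i) k

theorem logPart_euler (hl0 : ∀ i, l i ≠ 0) (hlh : ∀ i, (l i).IsHomogeneous 1) (k : Fin p) :
    logPart l (eulerDer n) k = 1 :=
  logPart_eq hl0 (by rw [eulerDer_apply (hlh k), one_smul, mul_one])

theorem logPart_zero (hl0 : ∀ i, l i ≠ 0) (k : Fin p) : logPart l (0 : Der n) k = 0 :=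
  logPart_eq hl0 (by simp)

theorem lie_apply_linear {χ χ' : Der n} (hχ : χ ∈ DA l) (hχ' : χ' ∈ DA l) (k : Fin p) :
    ⁅χ, χ'⁆ (l k) = l k * (χ (logPart l χ' k) - χ' (logPart l χ k)) := by
  rw [Derivation.commutator_apply, apply_eq_mul_logPart hχ', apply_eq_mul_logPart hχ,
    χ.leibniz, χ'.leibniz, apply_eq_mul_logPart hχ', apply_eq_mul_logPart hχ]
  simp only [smul_eq_mul]
  ring

theorem lie_mem_DA {χ χ' : Der n} (hχ : χ ∈ DA l) (hχ' : χ' ∈ DA l) : ⁅χ, χ'⁆ ∈ DA l :=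
  mem_DA.2 fun k => ⟨_, lie_apply_linear hχ hχ' k⟩

theorem logPart_lie (hl0 : ∀ i, l i ≠ 0) {χ χ' : Der n} (hχ : χ ∈ DA l) (hχ' : χ' ∈ DA l)
    (k : Fin p) : logPart l ⁅χ, χ'⁆ k = χ (logPart l χ' k) - χ' (logPart l χ k) :=
  logPart_eq hl0 (lie_apply_linear hχ hχ' k)

theorem logPart_isHomogeneous (hl0 : ∀ i, l i ≠ 0) (hlh : ∀ i, (l i).IsHomogeneous 1)
    {χ : Der n} (hχ : χ ∈ DA l) {d : ℕ} (hd : IsHomDer χ (d + 1)) (k : Fin p) :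
    (logPart l χ k).IsHomogeneous d := by
  have h := homogeneousComponent_mul_of_le (hlh k) (Nat.le_add_left 1 d) (logPart l χ k)
  rw [← apply_eq_mul_logPart hχ, homogeneousComponent_of_mem (m := d + 1)
    ((mem_homogeneousSubmodule _ _).2 (hd.linearForm (hlh k))), if_pos rfl,
    apply_eq_mul_logPart hχ] at h
  rw [mul_left_cancel₀ (hl0 k) h]
  exact homogeneousComponent_isHomogeneous _ _

theorem derivation_prod_pow {χ : Der n} (hχ : χ ∈ DA l) (r : ℕ) :
    χ ((∏ k, l k) ^ r) = (∏ k, l k) ^ r * (r * ∑ k, logPart l χ k) := by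
  have h1 : χ (∏ k, l k) = (∏ k, l k) * ∑ k, logPart l χ k := by
    have h : ∀ s : Finset (Fin p), χ (∏ k ∈ s, l k) = (∏ k ∈ s, l k) * ∑ k ∈ s, logPart l χ k := by
      classical
      intro s
      induction s using Finset.induction_on with
      | empty => simp
      | insert a s ha ih =>
        rw [Finset.prod_insert ha, Finset.sum_insert ha, χ.leibniz, ih, apply_eq_mul_logPart hχ]
        simp only [smul_eq_mul]
        ring
    exact h _
  rw [χ.leibniz_pow, h1]
  rcases r with _ | r
  · simp
  · simp only [Nat.add_sub_cancel, smul_eq_mul, nsmul_eq_mul, pow_succ]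
    ring

/-- The weighted sum of the logarithmic parts of `χ`. -/
noncomputable def weight (l : Fin p → MvPolynomial (Fin n) ℂ) (α : Fin p → ℂ) (χ : Der n) :
    MvPolynomial (Fin n) ℂ :=
  ∑ k, C (α k) * logPart l χ k

theorem weight_smul (hl0 : ∀ i, l i ≠ 0) (α : Fin p → ℂ) {χ : Der n} (hχ : χ ∈ DA l)
    (c : MvPolynomial (Fin n) ℂ) : weight l α (c • χ) = c * weight l α χ := by
  simp only [weight, Finset.mul_sum, logPart_smul hl0 hχ]
  exact Finset.sum_congr rfl fun k _ => by ring

theorem weight_sum (hl0 : ∀ i, l i ≠ 0) (α : Fin p → ℂ) {ι : Type*} (s : Finset ι)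
    {χ : ι → Der n} (hχ : ∀ i, χ i ∈ DA l) :
    weight l α (∑ i ∈ s, χ i) = ∑ i ∈ s, weight l α (χ i) := by
  simp only [weight, logPart_sum hl0 s hχ, Finset.mul_sum]
  exact Finset.sum_comm

theorem weight_zero (hl0 : ∀ i, l i ≠ 0) (α : Fin p → ℂ) : weight l α (0 : Der n) = 0 := by
  simp [weight, logPart_zero hl0]

theorem weight_euler (hl0 : ∀ i, l i ≠ 0) (hlh : ∀ i, (l i).IsHomogeneous 1) (α : Fin p → ℂ) :
    weight l α (eulerDer n) = C (∑ k, α k) := by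
  simp [weight, logPart_euler hl0 hlh]

theorem weight_lie (hl0 : ∀ i, l i ≠ 0) (α : Fin p → ℂ) {χ χ' : Der n} (hχ : χ ∈ DA l)
    (hχ' : χ' ∈ DA l) :
    weight l α ⁅χ, χ'⁆ = χ (weight l α χ') - χ' (weight l α χ) := by
  have h : ∀ (η : Der n) (c : ℂ) (g : MvPolynomial (Fin n) ℂ), η (C c * g) = C c * η g := by
    intro η c g
    rw [← smul_eq_C_mul, η.map_smul, smul_eq_C_mul]
  simp only [weight, logPart_lie hl0 hχ hχ', map_sum, h, mul_sub, Finset.sum_sub_distrib]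

theorem weight_isHomogeneous (hl0 : ∀ i, l i ≠ 0) (hlh : ∀ i, (l i).IsHomogeneous 1)
    (α : Fin p → ℂ) {χ : Der n} (hχ : χ ∈ DA l) {d : ℕ} (hd : IsHomDer χ (d + 1)) :
    (weight l α χ).IsHomogeneous d :=
  IsHomogeneous.sum _ _ _ fun k _ => by
    have := (isHomogeneous_C (Fin n) (α k)).mul (logPart_isHomogeneous hl0 hlh hχ hd k)
    rwa [zero_add] at this

end LogPart

section GenericWeights

variable {n p : ℕ} {l : Fin p → MvPolynomial (Fin n) ℂ}

theorem exists_generic_weights (k₀ : Fin p) : ∃ β : Fin p → ℂ, ∑ k, β k = 0 ∧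
    ∀ s : Finset (Fin p), s.Nonempty → s ≠ Finset.univ → ∑ k ∈ s, β k ≠ 0 := by
  classical
  refine ⟨fun k => 1 - if k = k₀ then (p : ℂ) else 0, by simp, fun s hs hs' h => ?_⟩
  rw [Finset.sum_sub_distrib, Finset.sum_const, nsmul_eq_mul, mul_one, Finset.sum_ite_eq',
    sub_eq_zero] at h
  split_ifs at h
  · have : s.card = p := by exact_mod_cast h
    exact hs' ((Finset.card_eq_iff_eq_univ s).1 (by simpa using this))
  · have : s.card = 0 := by exact_mod_cast h
    exact hs.ne_empty (Finset.card_eq_zero.1 this)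

/-- The linear derivation associated to an endomorphism of `ℂⁿ`. -/
theorem exists_linear_derivation (L : (Fin n → ℂ) →ₗ[ℂ] (Fin n → ℂ)) :
    ∃ χ : Der n, ∀ f : MvPolynomial (Fin n) ℂ, f.IsHomogeneous 1 →
      (χ f).IsHomogeneous 1 ∧ ∀ x, eval x (χ f) = toLin f (L x) := by
  refine ⟨mkDerivation ℂ fun i => ∑ j, C (L (Pi.single j 1) i) * X j, fun f hf => ⟨?_, ?_⟩⟩
  · refine IsHomDer.linearForm (fun i => ?_) hf
    rw [mkDerivation_X]
    refine IsHomogeneous.sum _ _ _ fun j _ => ?_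
    have := (isHomogeneous_C (Fin n) (L (Pi.single j 1) i)).mul (isHomogeneous_X ℂ j)
    rwa [zero_add] at this
  · intro x
    rw [derivation_linearForm hf, toLin_apply, map_sum]
    refine Finset.sum_congr rfl fun i _ => ?_
    rw [mkDerivation_X]
    simp only [map_mul, eval_C, map_sum, eval_X]
    congr 1
    conv_rhs => rw [← LinearMap.sum_single_apply (fun _ => ℂ) x]
    rw [map_sum, Finset.sum_apply]
    refine Finset.sum_congr rfl fun j _ => ?_
    have : (Pi.single j (x j) : Fin n → ℂ) = x j • Pi.single j 1 := by
      rw [← Pi.single_smul, smul_eq_mul, mul_one]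
    rw [this, L.map_smul, Pi.smul_apply, smul_eq_mul, mul_comm]

theorem weight_common_zeros (hl0 : ∀ i, l i ≠ 0) (hlh : ∀ i, (l i).IsHomogeneous 1)
    (hess : (⨅ i, hyp l i) = ⊥) {β : Fin p → ℂ} (hβ0 : ∑ k, β k = 0)
    (hβ : ∀ s : Finset (Fin p), s.Nonempty → s ≠ Finset.univ → ∑ k ∈ s, β k ≠ 0)
    {k₀ : Fin p} {i₀ : Fin n} {δ : Fin n → Der n} {d : Fin n → ℕ}
    (hδ : IsNormalizedGen l k₀ i₀ δ d) (x : Fin n → ℂ)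
    (hx : ∀ i, i ≠ i₀ → eval x (weight l β (δ i)) = 0) (hF : eval x (∏ k, l k) = 0) : x = 0 := by
  classical
  by_contra hx0
  let s : Finset (Fin p) := Finset.univ.filter fun k => toLin (l k) x = 0
  have hs : ∀ k, k ∈ s ↔ toLin (l k) x = 0 := fun k => by simp [s]
  have hsne : s.Nonempty := by
    rw [map_prod, Finset.prod_eq_zero_iff] at hF
    obtain ⟨k, -, hk⟩ := hF
    exact ⟨k, (hs k).2 (by rw [← eval_linearForm (hlh k), hk])⟩
  have hsuniv : s ≠ Finset.univ := by
    intro h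
    have : x ∈ ⨅ i, hyp l i :=
      (Submodule.mem_iInf _).2 fun k => (hs k).1 (h ▸ Finset.mem_univ k)
    rw [hess, Submodule.mem_bot] at this
    exact hx0 this
  let V : Submodule ℂ (Fin n → ℂ) := ⨅ k ∈ s, hyp l k
  have hxV : x ∈ V := by
    simp only [V, Submodule.mem_iInf]
    exact fun k hk => (hs k).1 hk
  obtain ⟨V', hV'⟩ := V.exists_isCompl
  -- the projection onto `V'` along `V`
  let L : (Fin n → ℂ) →ₗ[ℂ] (Fin n → ℂ) := V'.projection V hV'.symm
  have hLx : L x = 0 := (Submodule.projection_apply_eq_zero_iff hV'.symm).2 hxV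
  have hLs : ∀ k ∈ s, ∀ y, toLin (l k) (L y) = toLin (l k) y := by
    intro k hk y
    have h1 : L (y - L y) = 0 := by
      rw [map_sub, sub_eq_zero]
      exact (Submodule.projection_apply_of_mem_left hV'.symm
        (Submodule.projection_apply_mem hV'.symm y)).symm
    have h2 : y - L y ∈ V := (Submodule.projection_apply_eq_zero_iff hV'.symm).1 h1
    simp only [V, Submodule.mem_iInf] at h2
    have h3 : toLin (l k) (y - L y) = 0 := h2 k hk
    rw [map_sub, sub_eq_zero] at h3
    exact h3.symm
  obtain ⟨χ, hχ⟩ := exists_linear_derivation L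
  let g : MvPolynomial (Fin n) ℂ := ∏ k ∈ sᶜ, l k
  have hχs : ∀ k ∈ s, χ (l k) = l k := by
    intro k hk
    refine MvPolynomial.funext fun y => ?_
    rw [(hχ _ (hlh k)).2, hLs k hk, eval_linearForm (hlh k)]
  have hgs : ∀ k ∈ s, (g • χ) (l k) = l k * g := by
    intro k hk
    rw [Derivation.coe_smul, Pi.smul_apply, smul_eq_mul, hχs k hk, mul_comm]
  have hgsc : ∀ k ∈ sᶜ, (g • χ) (l k) = l k * ((∏ k' ∈ sᶜ.erase k, l k') * χ (l k)) := by
    intro k hk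
    rw [Derivation.coe_smul, Pi.smul_apply, smul_eq_mul, ← mul_assoc, Finset.mul_prod_erase _ _ hk]
  have hmem : g • χ ∈ DA l := by
    refine mem_DA.2 fun k => ?_
    by_cases hk : k ∈ s
    · exact ⟨_, hgs k hk⟩
    · exact ⟨_, hgsc k (Finset.mem_compl.2 hk)⟩
  have hw : eval x (weight l β (g • χ)) = eval x g * ∑ k ∈ s, β k := by
    rw [weight, map_sum, ← Finset.sum_add_sum_compl s, Finset.mul_sum]
    have h1 : ∑ k ∈ sᶜ, eval x (C (β k) * logPart l (g • χ) k) = 0 := by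
      refine Finset.sum_eq_zero fun k hk => ?_
      rw [logPart_eq hl0 (hgsc k hk), map_mul, map_mul, (hχ _ (hlh k)).2, hLx, map_zero, mul_zero,
        mul_zero]
    rw [h1, add_zero]
    refine Finset.sum_congr rfl fun k hk => ?_
    rw [logPart_eq hl0 (hgs k hk), map_mul, eval_C, mul_comm]
  have hg : eval x g ≠ 0 := by
    rw [map_prod, Finset.prod_ne_zero_iff]
    intro k hk h
    rw [eval_linearForm (hlh k)] at h
    exact Finset.mem_compl.1 hk ((hs k).2 h)
  obtain ⟨c, hc⟩ := hδ.gen _ hmem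
  refine mul_ne_zero hg (hβ s hsne hsuniv) ?_
  rw [← hw, hc, weight_sum hl0 _ _ fun i => (DA l).smul_mem _ (hδ.mem i), map_sum]
  refine Finset.sum_eq_zero fun i _ => ?_
  rw [weight_smul hl0 _ (hδ.mem i), map_mul]
  by_cases hi : i = i₀
  · rw [hi, hδ.euler, weight_euler hl0 hlh, hβ0, C_0, map_zero, mul_zero]
  · rw [hx i hi, mul_zero]

end GenericWeights

section Twist

variable {n p : ℕ} {l : Fin p → MvPolynomial (Fin n) ℂ}

/-- The divergence of a derivation. -/
noncomputable def divergence (χ : Der n) : MvPolynomial (Fin n) ℂ :=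
  ∑ i, pderiv i (χ (X i))

theorem divergence_smul (c : MvPolynomial (Fin n) ℂ) (χ : Der n) :
    divergence (c • χ) = c * divergence χ + χ c := by
  rw [derivation_apply χ c, divergence, divergence, Finset.mul_sum, ← Finset.sum_add_distrib]
  refine Finset.sum_congr rfl fun i _ => ?_
  simp [Derivation.leibniz]

theorem divergence_sum {ι : Type*} (s : Finset ι) (χ : ι → Der n) :
    divergence (∑ i ∈ s, χ i) = ∑ i ∈ s, divergence (χ i) := by
  simp only [divergence, derivation_sum_apply, map_sum]
  exact Finset.sum_comm

theorem divergence_zero : divergence (0 : Der n) = 0 := by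
  simp [divergence]

theorem divergence_euler : divergence (eulerDer n) = n := by
  simp [divergence]

theorem divergence_lie (χ χ' : Der n) :
    divergence ⁅χ, χ'⁆ = χ (divergence χ') - χ' (divergence χ) := by
  have h : ∀ (η η' : Der n), ∑ i, pderiv i (η (η' (X i)))
      = η (divergence η') + ∑ i, ∑ j, pderiv i (η (X j)) * pderiv j (η' (X i)) := by
    intro η η'
    rw [divergence, map_sum, ← Finset.sum_add_distrib]
    refine Finset.sum_congr rfl fun i _ => ?_
    rw [derivation_apply η (η' (X i)), derivation_apply η (pderiv i _), map_sum,
      ← Finset.sum_add_distrib]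
    refine Finset.sum_congr rfl fun j _ => ?_
    have hc : pderiv i (pderiv j (η' (X i))) = pderiv j (pderiv i (η' (X i))) := by
      have : ⁅(pderiv i : Der n), (pderiv j : Der n)⁆ = 0 := by
        classical
        refine derivation_ext fun k => ?_
        rw [Derivation.commutator_apply, pderiv_X, pderiv_X, Pi.single_apply, Pi.single_apply]
        split_ifs <;> simp
      have h2 := congrArg (fun D : Der n => D (η' (X i))) this
      simpa [Derivation.commutator_apply, sub_eq_zero] using h2
    rw [Derivation.leibniz, hc]
    simp only [smul_eq_mul]
    ring
  have h1 : divergence ⁅χ, χ'⁆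
      = ∑ i, pderiv i (χ (χ' (X i))) - ∑ i, pderiv i (χ' (χ (X i))) := by
    simp only [divergence, Derivation.commutator_apply, map_sub, Finset.sum_sub_distrib]
  have h2 : ∑ i, ∑ j, pderiv i (χ (X j)) * pderiv j (χ' (X i))
      = ∑ i, ∑ j, pderiv i (χ' (X j)) * pderiv j (χ (X i)) := by
    rw [Finset.sum_comm]
    exact Finset.sum_congr rfl fun i _ => Finset.sum_congr rfl fun j _ => mul_comm _ _
  rw [h1, h, h, h2]
  ring

/-- The twisted transpose of a logarithmic derivation: the operator
`g ↦ χ g + (div χ + ∑ αₖ χ(lₖ)/lₖ) g`. -/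
noncomputable def twist (l : Fin p → MvPolynomial (Fin n) ℂ) (α : Fin p → ℂ) (χ : Der n) :
    MvPolynomial (Fin n) ℂ →ₗ[ℂ] MvPolynomial (Fin n) ℂ :=
  (χ : MvPolynomial (Fin n) ℂ →ₗ[ℂ] MvPolynomial (Fin n) ℂ)
    + LinearMap.mulLeft ℂ (divergence χ + weight l α χ)

theorem twist_apply (α : Fin p → ℂ) (χ : Der n) (g : MvPolynomial (Fin n) ℂ) :
    twist l α χ g = χ g + (divergence χ + weight l α χ) * g :=
  rfl

theorem twist_mul (α : Fin p → ℂ) (χ : Der n) (a g : MvPolynomial (Fin n) ℂ) :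
    twist l α χ (a * g) = a * twist l α χ g + χ a * g := by
  rw [twist_apply, twist_apply, χ.leibniz]
  simp only [smul_eq_mul]
  ring

theorem twist_zero (hl0 : ∀ i, l i ≠ 0) (α : Fin p → ℂ) (g : MvPolynomial (Fin n) ℂ) :
    twist l α 0 g = 0 := by
  simp [twist_apply, divergence_zero, weight_zero hl0]

theorem twist_smul (hl0 : ∀ i, l i ≠ 0) (α : Fin p → ℂ) {χ : Der n} (hχ : χ ∈ DA l)
    (c g : MvPolynomial (Fin n) ℂ) : twist l α (c • χ) g = twist l α χ (c * g) := by
  rw [twist_mul, twist_apply, twist_apply, divergence_smul, weight_smul hl0 _ hχ,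
    Derivation.coe_smul, Pi.smul_apply, smul_eq_mul]
  ring

theorem twist_sum (hl0 : ∀ i, l i ≠ 0) (α : Fin p → ℂ) {ι : Type*} (s : Finset ι)
    {χ : ι → Der n} (hχ : ∀ i, χ i ∈ DA l) (g : MvPolynomial (Fin n) ℂ) :
    twist l α (∑ i ∈ s, χ i) g = ∑ i ∈ s, twist l α (χ i) g := by
  simp only [twist_apply, derivation_sum_apply, divergence_sum, weight_sum hl0 α s hχ,
    Finset.sum_add_distrib, add_mul, Finset.sum_mul]

theorem twist_lie (hl0 : ∀ i, l i ≠ 0) (α : Fin p → ℂ) {χ χ' : Der n} (hχ : χ ∈ DA l)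
    (hχ' : χ' ∈ DA l) (g : MvPolynomial (Fin n) ℂ) :
    twist l α ⁅χ, χ'⁆ g = twist l α χ (twist l α χ' g) - twist l α χ' (twist l α χ g) := by
  simp only [twist_apply, divergence_lie, weight_lie hl0 α hχ hχ', Derivation.commutator_apply,
    map_add, Derivation.leibniz, smul_eq_mul]
  ring

theorem twist_prod_pow_mul (α : Fin p → ℂ) {χ : Der n} (hχ : χ ∈ DA l) (r : ℕ)
    (g : MvPolynomial (Fin n) ℂ) :
    twist l α χ ((∏ k, l k) ^ r * g) = (∏ k, l k) ^ r * twist l (fun k => α k + r) χ g := by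
  have h : weight l (fun k => α k + r) χ = weight l α χ + r * ∑ k, logPart l χ k := by
    simp only [weight, C_add, add_mul, Finset.sum_add_distrib, Finset.mul_sum]
    simp
  rw [twist_mul, derivation_prod_pow hχ, twist_apply, twist_apply, h]
  ring

theorem twist_euler (hl0 : ∀ i, l i ≠ 0) (hlh : ∀ i, (l i).IsHomogeneous 1) (α : Fin p → ℂ)
    {g : MvPolynomial (Fin n) ℂ} {w : ℕ} (hg : g.IsHomogeneous w) :
    twist l α (eulerDer n) g = C (w + n + ∑ k, α k) * g := by
  rw [twist_apply, eulerDer_apply hg, divergence_euler, weight_euler hl0 hlh]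
  simp only [C_add, nsmul_eq_mul]
  have : ∀ m : ℕ, (C (m : ℂ) : MvPolynomial (Fin n) ℂ) = m := fun m => map_natCast C m
  rw [this, this]
  ring

theorem twist_isHomogeneous (hl0 : ∀ i, l i ≠ 0) (hlh : ∀ i, (l i).IsHomogeneous 1)
    (α : Fin p → ℂ) {χ : Der n} (hχ : χ ∈ DA l) {d : ℕ} (hd : IsHomDer χ (d + 1))
    {g : MvPolynomial (Fin n) ℂ} {w : ℕ} (hg : g.IsHomogeneous w) :
    (twist l α χ g).IsHomogeneous (w + d) := by
  rw [twist_apply, add_mul, ← add_assoc]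
  refine ((hd.apply hg).add ?_).add ?_
  · rw [add_comm]
    refine IsHomogeneous.mul (IsHomogeneous.sum _ _ _ fun i _ => ?_) hg
    have := (hd i).pderiv (i := i)
    rwa [Nat.add_sub_cancel] at this
  · rw [add_comm]
    exact (weight_isHomogeneous hl0 hlh α hχ hd).mul hg

/-- The homogeneous components of `twist l α χ g` and `weight l β χ * g` come from a common
homogeneous component of `g`. -/
theorem exists_homogeneousComponent_twist (hl0 : ∀ i, l i ≠ 0)
    (hlh : ∀ i, (l i).IsHomogeneous 1) {χ : Der n} (hχ : χ ∈ DA l) {d : ℕ}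
    (hd : IsHomDer χ (d + 1)) (w : ℕ) :
    ∃ π : MvPolynomial (Fin n) ℂ →ₗ[ℂ] MvPolynomial (Fin n) ℂ, ∀ g,
      (∀ α : Fin p → ℂ, homogeneousComponent w (twist l α χ g) = twist l α χ (π g)) ∧
      (∀ β : Fin p → ℂ, homogeneousComponent w (weight l β χ * g) = weight l β χ * π g) ∧
      (π g).IsHomogeneous (w - d) := by
  have key : ∀ (T : MvPolynomial (Fin n) ℂ →ₗ[ℂ] MvPolynomial (Fin n) ℂ)
      (_ : ∀ v g, g.IsHomogeneous v → (T g).IsHomogeneous (v + d)) (g : MvPolynomial (Fin n) ℂ),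
      homogeneousComponent w (T g) = if d ≤ w then T (homogeneousComponent (w - d) g) else 0 := by
    intro T hT g
    conv_lhs => rw [← sum_homogeneousComponent g]
    rw [map_sum, map_sum]
    have h1 : ∀ v, homogeneousComponent w (T (homogeneousComponent v g))
        = if w = v + d then T (homogeneousComponent v g) else 0 := fun v =>
      homogeneousComponent_of_mem (m := w)
        ((mem_homogeneousSubmodule _ _).2 (hT v _ (homogeneousComponent_isHomogeneous v g)))
    simp only [h1]
    split_ifs with hw
    · by_cases hv : w - d < g.totalDegree + 1
      · rw [Finset.sum_eq_single_of_mem (w - d) (Finset.mem_range.2 hv)]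
        · rw [if_pos (by omega)]
        · intro v _ hvw
          rw [if_neg (by omega)]
      · rw [homogeneousComponent_eq_zero _ _ (by omega), map_zero]
        refine Finset.sum_eq_zero fun v hv' => ?_
        have := Finset.mem_range.1 hv'
        rw [if_neg (by omega)]
    · refine Finset.sum_eq_zero fun v _ => ?_
      rw [if_neg (by omega)]
  refine ⟨if d ≤ w then homogeneousComponent (w - d) else 0,
    fun g => ⟨fun α => ?_, fun β => ?_, ?_⟩⟩
  · rw [key _ fun v g hg => twist_isHomogeneous hl0 hlh α hχ hd hg]
    split_ifs <;> simp
  · have := key (LinearMap.mulLeft ℂ (weight l β χ)) (fun v g hg => by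
      rw [add_comm]
      exact (weight_isHomogeneous hl0 hlh β hχ hd).mul hg) g
    rw [LinearMap.mulLeft_apply] at this
    rw [this]
    split_ifs <;> simp
  · split_ifs
    · exact homogeneousComponent_isHomogeneous _ _
    · exact isHomogeneous_zero _ _ _

end Twist

section Descent

variable {n p : ℕ} {l : Fin p → MvPolynomial (Fin n) ℂ}

theorem sum_sum_half_sub {c e : Fin n → Fin n → MvPolynomial (Fin n) ℂ}
    (hc : ∀ i j, c i j = -c j i) :
    ∑ i, ∑ j, e i j * c i j = ∑ i, ∑ j, C (1 / 2 : ℂ) * ((e i j - e j i) * c i j) := by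
  have h1 : ∑ i, ∑ j, e j i * c i j = -∑ i, ∑ j, e i j * c i j := by
    rw [Finset.sum_comm, ← Finset.sum_neg_distrib]
    refine Finset.sum_congr rfl fun i _ => ?_
    rw [← Finset.sum_neg_distrib]
    refine Finset.sum_congr rfl fun j _ => ?_
    rw [hc j i]
    ring
  have h2 : (C (1 / 2 : ℂ) : MvPolynomial (Fin n) ℂ) * 2 = 1 := by
    rw [show (2 : MvPolynomial (Fin n) ℂ) = C 2 from (map_ofNat C 2).symm, ← C_mul]
    norm_num
  simp only [← Finset.mul_sum, sub_mul, Finset.sum_sub_distrib]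
  rw [h1, sub_neg_eq_add, ← two_mul, ← mul_assoc, h2, one_mul]

/-- A syzygy of the leading parts can be corrected modulo lower order terms. -/
theorem exists_correction (hl0 : ∀ i, l i ≠ 0) {β : Fin p → ℂ} {i₀ : Fin n}
    {δ : Fin n → Der n} (hδ : ∀ i, δ i ∈ DA l) (hδ0 : δ i₀ = 0)
    {e : Fin n → Fin n → Fin n → MvPolynomial (Fin n) ℂ}
    (he : ∀ i j, ⁅δ i, δ j⁆ = ∑ k, e i j k • δ k) {r : ℕ} (hr : r ≠ 0)
    (hV : ∀ x, (∀ i, i ≠ i₀ → eval x (weight l β (δ i)) = 0) → eval x (∏ k, l k) = 0 → x = 0)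
    (α : Fin p → ℂ) {h : MvPolynomial (Fin n) ℂ} {γ : Fin n → MvPolynomial (Fin n) ℂ}
    (hγ : (∏ k, l k) ^ r * h + ∑ i, weight l β (δ i) * γ i = 0) :
    ∃ (h' : MvPolynomial (Fin n) ℂ) (v : Fin n → MvPolynomial (Fin n) ℂ),
      ∑ i, twist l α (δ i) (γ i) = (∏ k, l k) ^ r * h' + ∑ i, weight l β (δ i) * v i ∧
      ∑ i, twist l α (δ i) (v i) = 0 := by
  classical
  set F := ∏ k, l k
  set a : Fin n → MvPolynomial (Fin n) ℂ := fun i => weight l β (δ i) with ha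
  have ha0 : a i₀ = 0 := by rw [ha]; simp only [hδ0, weight_zero hl0]
  let f : Fin n → MvPolynomial (Fin n) ℂ := fun i => a i + if i = i₀ then F ^ r else 0
  obtain ⟨c, hc, hg⟩ := exists_antisymm_of_zeros f (by
    intro x hx
    refine hV x (fun i hi => ?_) ?_
    · have := hx i
      simp only [f, if_neg hi, add_zero] at this
      exact this
    · have := hx i₀
      simp only [f, if_true, ha0, zero_add, map_pow] at this
      exact (pow_eq_zero_iff hr).1 this) (fun i => if i = i₀ then h else γ i) (by
    rw [← hγ, ← Finset.add_sum_erase _ _ (Finset.mem_univ i₀),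
      ← Finset.add_sum_erase _ (fun i => weight l β (δ i) * γ i) (Finset.mem_univ i₀)]
    have h1 : weight l β (δ i₀) = 0 := ha0
    simp only [f, if_true, ha0, h1, zero_add, zero_mul]
    congr 1
    refine Finset.sum_congr rfl fun i hi => ?_
    simp [Finset.ne_of_mem_erase hi, ha])
  have hγ' : ∀ i, twist l α (δ i) (γ i)
      = F ^ r * twist l (fun k => α k + r) (δ i) (c i i₀)
        + ∑ j, (a j * twist l α (δ i) (c i j) + δ i (a j) * c i j) := by
    intro i
    by_cases hi : i = i₀
    · simp [hi, hδ0, twist_zero hl0]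
    · have h1 := hg i
      simp only [if_neg hi] at h1
      have h2 : ∑ j, f j * c i j = F ^ r * c i i₀ + ∑ j, a j * c i j := by
        simp only [f, add_mul, Finset.sum_add_distrib, ite_mul, zero_mul, Finset.sum_ite_eq',
          Finset.mem_univ, if_true]
        rw [add_comm]
      rw [h1, h2, map_add, twist_prod_pow_mul α (hδ i), map_sum]
      simp only [twist_mul, F]
  have hlie : ∀ i j, δ i (a j) - δ j (a i) = ∑ k, e i j k * a k := by
    intro i j
    rw [ha]
    simp only
    rw [← weight_lie hl0 β (hδ i) (hδ j), he,
      weight_sum hl0 _ _ fun k => (DA l).smul_mem _ (hδ k)]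
    exact Finset.sum_congr rfl fun k _ => weight_smul hl0 _ (hδ k) _
  have hlie' : ∀ i j g, ∑ k, twist l α (δ k) (e i j k * g)
      = twist l α (δ i) (twist l α (δ j) g) - twist l α (δ j) (twist l α (δ i) g) := by
    intro i j g
    rw [← twist_lie hl0 α (hδ i) (hδ j), he,
      twist_sum hl0 _ _ fun k => (DA l).smul_mem _ (hδ k)]
    exact Finset.sum_congr rfl fun k _ => (twist_smul hl0 α (hδ k) _ _).symm
  refine ⟨∑ i, twist l (fun k => α k + r) (δ i) (c i i₀),
    fun k => ∑ i, twist l α (δ i) (c i k) + ∑ i, ∑ j, C (1 / 2 : ℂ) * (e i j k * c i j), ?_, ?_⟩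
  · simp only [hγ', Finset.sum_add_distrib, ← Finset.mul_sum, mul_add]
    congr 2
    · simp only [Finset.mul_sum]
      exact Finset.sum_comm
    · rw [sum_sum_half_sub hc]
      simp only [hlie, Finset.sum_mul, Finset.mul_sum]
      rw [Finset.sum_comm (s := Finset.univ (α := Fin n)) (γ := Fin n)
        (f := fun k i => ∑ j, weight l β (δ k) * (C (1 / 2 : ℂ) * (e i j k * c i j)))]
      refine Finset.sum_congr rfl fun i _ => ?_
      rw [Finset.sum_comm]
      refine Finset.sum_congr rfl fun j _ => Finset.sum_congr rfl fun k _ => ?_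
      simp only [ha]
      ring
  · have hC : ∀ k g, twist l α (δ k) (C (1 / 2 : ℂ) * g) = C (1 / 2 : ℂ) * twist l α (δ k) g := by
      intro k g
      rw [← smul_eq_C_mul, map_smul, smul_eq_C_mul]
    have h1 : ∑ k, twist l α (δ k) (∑ i, ∑ j, C (1 / 2 : ℂ) * (e i j k * c i j))
        = C (1 / 2 : ℂ) * ∑ i, ∑ j, ∑ k, twist l α (δ k) (e i j k * c i j) := by
      simp only [map_sum, hC, Finset.mul_sum]
      rw [Finset.sum_comm]
      exact Finset.sum_congr rfl fun i _ => Finset.sum_comm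
    have h2 : ∑ i, ∑ j, twist l α (δ j) (twist l α (δ i) (c i j))
        = -∑ i, ∑ j, twist l α (δ i) (twist l α (δ j) (c i j)) := by
      rw [Finset.sum_comm, ← Finset.sum_neg_distrib]
      refine Finset.sum_congr rfl fun i _ => ?_
      rw [← Finset.sum_neg_distrib]
      refine Finset.sum_congr rfl fun j _ => ?_
      rw [hc j i, map_neg, map_neg]
    have h3 : (C (1 / 2 : ℂ) : MvPolynomial (Fin n) ℂ) * 2 = 1 := by
      rw [show (2 : MvPolynomial (Fin n) ℂ) = C 2 from (map_ofNat C 2).symm, ← C_mul]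
      norm_num
    simp only [map_add, Finset.sum_add_distrib]
    rw [h1]
    simp only [hlie', Finset.sum_sub_distrib]
    have h4 : ∑ k, twist l α (δ k) (∑ i, twist l α (δ i) (c i k))
        = ∑ i, ∑ j, twist l α (δ j) (twist l α (δ i) (c i j)) := by
      simp only [map_sum]
      exact Finset.sum_comm
    rw [h4, h2]
    linear_combination (∑ i, ∑ j, twist l α (δ i) (twist l α (δ j) (c i j))) * h3

theorem exists_leading_eq (hl0 : ∀ i, l i ≠ 0) {β : Fin p → ℂ} {i₀ : Fin n}
    {δ : Fin n → Der n} (hδ : ∀ i, δ i ∈ DA l) (hδ0 : δ i₀ = 0)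
    {e : Fin n → Fin n → Fin n → MvPolynomial (Fin n) ℂ}
    (he : ∀ i j, ⁅δ i, δ j⁆ = ∑ k, e i j k • δ k) {r : ℕ} (hr : r ≠ 0)
    (hV : ∀ x, (∀ i, i ≠ i₀ → eval x (weight l β (δ i)) = 0) → eval x (∏ k, l k) = 0 → x = 0)
    (α : Fin p → ℂ) {ρ : ℕ → MvPolynomial (Fin n) ℂ} {τ : ℕ} (hρ : ∀ k, τ < k → ρ k = 0)
    (N : ℕ) (hN : τ ≤ N) (h : ℕ → MvPolynomial (Fin n) ℂ)
    (γ : Fin n → ℕ → MvPolynomial (Fin n) ℂ)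
    (heq : ∀ k, ρ k = (∏ k, l k) ^ r * h k
      + ∑ i, (twist l α (δ i) (γ i (k + 1)) + weight l β (δ i) * γ i k))
    (hh : ∀ k, N < k → h k = 0) (hγ : ∀ i k, N < k → γ i k = 0) :
    ∃ (h' : MvPolynomial (Fin n) ℂ) (v : Fin n → MvPolynomial (Fin n) ℂ),
      ρ τ = (∏ k, l k) ^ r * h' + ∑ i, weight l β (δ i) * v i := by
  induction N, hN using Nat.le_induction generalizing h γ with
  | base =>
    refine ⟨h τ, fun i => γ i τ, ?_⟩
    rw [heq τ]
    congr 1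
    refine Finset.sum_congr rfl fun i _ => ?_
    rw [hγ i _ (Nat.lt_succ_self τ), map_zero, zero_add]
  | succ N hN ih =>
    have h1 : (∏ k, l k) ^ r * h (N + 1) + ∑ i, weight l β (δ i) * γ i (N + 1) = 0 := by
      rw [← hρ (N + 1) (by omega), heq (N + 1)]
      congr 1
      refine Finset.sum_congr rfl fun i _ => ?_
      rw [hγ i _ (Nat.lt_succ_self _), map_zero, zero_add]
    obtain ⟨h', v, hv1, hv2⟩ := exists_correction hl0 hδ hδ0 he hr hV α h1
    refine ih (fun k => if k = N + 1 then 0 else if k = N then h N + h' else h k)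
      (fun i k => if k = N + 1 then 0 else if k = N then γ i N + v i else γ i k) ?_ ?_ ?_
    · intro k
      by_cases hk : k = N + 1
      · subst hk
        simp [hρ (N + 1) (by omega), hγ _ (N + 1 + 1) (Nat.lt_succ_self _),
          show N + 1 + 1 ≠ N by omega]
      by_cases hk' : k = N
      · subst hk'
        simp only [if_true, Nat.succ_ne_self, if_false, left_eq_add, one_ne_zero, map_zero,
          zero_add]
        rw [heq k]
        simp only [Finset.sum_add_distrib, mul_add]
        rw [hv1]
        ring
      by_cases hk2 : k + 1 = N
      · subst hk2
        simp only [hk, if_false, hk', if_true, left_eq_add, one_ne_zero]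
        rw [heq k]
        simp only [Finset.sum_add_distrib, map_add, hv2, add_zero]
      · have h3 : k + 1 ≠ N + 1 := fun h => hk' (Nat.succ_injective h)
        simp only [hk, if_false, hk', hk2, h3]
        exact heq k
    · intro k hk
      by_cases hk1 : k = N + 1
      · simp [hk1]
      · simp only [hk1, if_false, (Nat.ne_of_gt hk : k ≠ N)]
        exact hh k (by omega)
    · intro i k hk
      by_cases hk1 : k = N + 1
      · simp [hk1]
      · simp only [hk1, if_false, (Nat.ne_of_gt hk : k ≠ N)]
        exact hγ i k (by omega)

/-- The product of the forms is a nonzerodivisor modulo the weights of the derivations. -/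
theorem exists_eq_of_prod_pow_mul (hl0 : ∀ i, l i ≠ 0) {β : Fin p → ℂ} {i₀ : Fin n}
    {δ : Fin n → Der n} (hδ0 : δ i₀ = 0) {r : ℕ} (hr : r ≠ 0)
    (hV : ∀ x, (∀ i, i ≠ i₀ → eval x (weight l β (δ i)) = 0) → eval x (∏ k, l k) = 0 → x = 0)
    {q : MvPolynomial (Fin n) ℂ} {g : Fin n → MvPolynomial (Fin n) ℂ}
    (hq : (∏ k, l k) ^ r * q = ∑ i, weight l β (δ i) * g i) :
    ∃ c : Fin n → MvPolynomial (Fin n) ℂ, q = ∑ i, weight l β (δ i) * c i := by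
  classical
  have ha0 : weight l β (δ i₀) = 0 := by rw [hδ0, weight_zero hl0]
  let f : Fin n → MvPolynomial (Fin n) ℂ :=
    fun i => if i = i₀ then (∏ k, l k) ^ r else weight l β (δ i)
  obtain ⟨c, hc, hg⟩ := exists_antisymm_of_zeros f (by
    intro x hx
    refine hV x (fun i hi => ?_) ?_
    · have := hx i
      rwa [show f i = _ from if_neg hi] at this
    · have := hx i₀
      rw [show f i₀ = _ from if_pos rfl, map_pow] at this
      exact (pow_eq_zero_iff hr).1 this) (fun i => if i = i₀ then q else -g i) (by
    rw [← Finset.add_sum_erase _ _ (Finset.mem_univ i₀)]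
    simp only [f, if_true]
    rw [hq, ← Finset.add_sum_erase _ _ (Finset.mem_univ i₀), ha0, zero_mul, zero_add,
      ← Finset.sum_add_distrib]
    refine Finset.sum_eq_zero fun i hi => ?_
    simp [Finset.ne_of_mem_erase hi])
  refine ⟨c i₀, ?_⟩
  have h1 := hg i₀
  simp only [if_true] at h1
  rw [h1]
  refine Finset.sum_congr rfl fun j _ => ?_
  by_cases hj : j = i₀
  · have : c i₀ i₀ = 0 := self_eq_neg.1 (hc i₀ i₀)
    rw [hj, this, mul_zero, mul_zero]
  · simp [f, hj]

end Descent

section NoRelation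

variable {n p : ℕ} {l : Fin p → MvPolynomial (Fin n) ℂ}

theorem exists_lie_coeff (hl0 : ∀ i, l i ≠ 0) {k₀ : Fin p} {i₀ : Fin n} {δ : Fin n → Der n}
    {d : Fin n → ℕ} (hδ : IsNormalizedGen l k₀ i₀ δ d) (hlh : ∀ i, (l i).IsHomogeneous 1)
    {i j : Fin n} (hi : i ≠ i₀) (hj : j ≠ i₀) :
    ∃ e : Fin n → MvPolynomial (Fin n) ℂ,
      ⁅δ i, δ j⁆ = ∑ k, e k • (if k = i₀ then 0 else δ k : Der n) := by
  obtain ⟨e, he⟩ := hδ.gen _ (lie_mem_DA (hδ.mem i) (hδ.mem j))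
  have h0 : e i₀ = 0 := by
    have h1 := congrArg (fun χ : Der n => χ (l k₀)) he
    simp only [Derivation.commutator_apply, hδ.annihilates i hi, hδ.annihilates j hj, map_zero,
      sub_zero, derivation_sum_apply] at h1
    rw [Finset.sum_eq_single_of_mem i₀ (Finset.mem_univ _)] at h1
    · rw [Derivation.coe_smul, Pi.smul_apply, hδ.euler, eulerDer_apply (hlh k₀), one_smul,
        smul_eq_mul] at h1
      exact (mul_eq_zero.1 h1.symm).resolve_right (hl0 k₀)
    · intro k _ hk
      rw [Derivation.coe_smul, Pi.smul_apply, hδ.annihilates k hk, smul_zero]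
  refine ⟨e, he.trans (Finset.sum_congr rfl fun k _ => ?_)⟩
  split_ifs with hk
  · rw [hk, h0, zero_smul, zero_smul]
  · rfl

theorem exists_notMem_span (hl0 : ∀ i, l i ≠ 0) (hlh : ∀ i, (l i).IsHomogeneous 1)
    {β : Fin p → ℂ} {k₀ : Fin p} {i₀ : Fin n} {δ : Fin n → Der n} {d : Fin n → ℕ}
    (hδ : IsNormalizedGen l k₀ i₀ δ d)
    (hV : ∀ x, (∀ i, i ≠ i₀ → eval x (weight l β (δ i)) = 0) → eval x (∏ k, l k) = 0 → x = 0)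
    {j : ℕ} (hj : j ≤ 2 * (p - n)) :
    ∃ q : MvPolynomial (Fin n) ℂ, q.IsHomogeneous j ∧
      q ∉ Ideal.span (Set.range fun i => if i = i₀ then ∏ k, l k else weight l β (δ i)) := by
  have hp : 1 ≤ p := k₀.pos
  refine exists_homogeneous_notMem _ (fun i => if i = i₀ then p else d i - 1) ?_ ?_ ?_ ?_
  · intro i
    split_ifs with hi
    · exact prod_isHomogeneous hlh
    · have h2 := hδ.two_le i hi
      refine weight_isHomogeneous hl0 hlh β (hδ.mem i) ?_
      rw [Nat.sub_add_cancel (by omega)]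
      exact hδ.hom i
  · intro i
    have := hδ.two_le i
    split_ifs with hi
    · exact hp
    · have := this hi
      omega
  · intro x hx
    refine hV x (fun i hi => ?_) ?_
    · have := hx i
      rwa [if_neg hi] at this
    · have := hx i₀
      rwa [if_pos rfl] at this
  · have h1 := hδ.card_le
    rw [← Finset.add_sum_erase _ _ (Finset.mem_univ i₀), hδ.degree_euler] at h1
    rw [← Finset.add_sum_erase _ _ (Finset.mem_univ i₀), if_pos rfl]
    have h2 : ∑ i ∈ Finset.univ.erase i₀, d i
        = ∑ i ∈ Finset.univ.erase i₀, ((if i = i₀ then p else d i - 1) - 1) + 2 * (n - 1) := by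
      have : 2 * (n - 1) = ∑ i ∈ Finset.univ.erase i₀, 2 := by
        rw [Finset.sum_const, Finset.card_erase_of_mem (Finset.mem_univ _)]
        simp [mul_comm]
      rw [this, ← Finset.sum_add_distrib]
      refine Finset.sum_congr rfl fun i hi => ?_
      have := hδ.two_le i (Finset.ne_of_mem_erase hi)
      rw [if_neg (Finset.ne_of_mem_erase hi)]
      omega
    have hn : 0 < n := i₀.pos
    omega

/-- The relation expressing that a line in parameter space, along which `b` does not vanish
identically, meets the hyperplane `∑ sₖ = -n-j` cannot hold. -/
theorem exists_no_relation (hp : 1 ≤ p) (hl0 : ∀ i, l i ≠ 0)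
    (hlh : ∀ i, (l i).IsHomogeneous 1)
    (hprop : ∀ i j, i ≠ j → ∀ c : ℂ, l i ≠ c • l j)
    (hfree : Module.Free (MvPolynomial (Fin n) ℂ) (DA l))
    (hirr : IrredOn l Finset.univ) (hess : (⨅ i, hyp l i) = ⊥) {j : ℕ} (hj : j ≤ 2 * (p - n)) :
    ∃ (β : Fin p → ℂ) (q : MvPolynomial (Fin n) ℂ), ∀ (α : Fin p → ℂ) (m : ℕ) (b : ℕ → ℂ) (N : ℕ)
      (h : ℕ → MvPolynomial (Fin n) ℂ) (G : Fin n → ℕ → MvPolynomial (Fin n) ℂ),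
      ∑ k, α k = -((n : ℂ) + j) → m ≠ 0 → (∃ k, b k ≠ 0) → (∀ k, N < k → b k = 0) →
      (∀ k, N < k → h k = 0) → (∀ i k, N < k → G i k = 0) →
      ¬ ∀ k, (∏ k, l k) ^ m * (C (b k) * q - (∏ k, l k) * h k)
        = ∑ i, (twist l (fun k => α k - m) ((∏ k, l k) • pderiv i) (G i (k + 1))
            + weight l β ((∏ k, l k) • pderiv i) * G i k) := by
  classical
  obtain ⟨i₀, δ, d, hδ⟩ := exists_isNormalizedGen ⟨0, hp⟩ hl0 hlh hprop hfree hirr hess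
  obtain ⟨β, hβ0, hβ⟩ := exists_generic_weights (p := p) ⟨0, hp⟩
  have hV := weight_common_zeros hl0 hlh hess hβ0 hβ hδ
  obtain ⟨q, hqj, hq⟩ := exists_notMem_span hl0 hlh hδ hV hj
  refine ⟨β, q, fun α m b N h G hα hm hb hbN hhN hGN hrel => hq ?_⟩
  set F := ∏ k, l k with hF
  have hFh : F.IsHomogeneous p := prod_isHomogeneous hlh
  have hF0 : F ≠ 0 := Finset.prod_ne_zero_iff.2 fun k _ => hl0 k
  -- the family of derivations with the Euler derivation removed
  let δ' : Fin n → Der n := fun i => if i = i₀ then 0 else δ i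
  have hδ'0 : δ' i₀ = 0 := if_pos rfl
  have hδ'1 : ∀ i, i ≠ i₀ → δ' i = δ i := fun i hi => if_neg hi
  have hδ'mem : ∀ i, δ' i ∈ DA l := by
    intro i
    by_cases hi : i = i₀
    · rw [hi, hδ'0]
      exact zero_mem _
    · rw [hδ'1 i hi]
      exact hδ.mem i
  have hlie : ∀ i j, ∃ e : Fin n → MvPolynomial (Fin n) ℂ, ⁅δ' i, δ' j⁆ = ∑ k, e k • δ' k := by
    intro i j
    by_cases hi : i = i₀
    · exact ⟨0, derivation_ext fun k => by simp [hi, hδ'0, Derivation.commutator_apply]⟩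
    by_cases hj : j = i₀
    · exact ⟨0, derivation_ext fun k => by simp [hj, hδ'0, Derivation.commutator_apply]⟩
    rw [hδ'1 i hi, hδ'1 j hj]
    exact exists_lie_coeff hl0 hδ hlh hi hj
  choose e he using hlie
  have hV' : ∀ x, (∀ i, i ≠ i₀ → eval x (weight l β (δ' i)) = 0) → eval x F = 0 → x = 0 := by
    intro x hx hFx
    refine hV x (fun i hi => ?_) hFx
    rw [← hδ'1 i hi]
    exact hx i hi
  -- expand in terms of the generators
  choose c hc using fun i : Fin n => hδ.gen _ (prod_smul_mem_DA (l := l) (pderiv i))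
  have hexp : ∀ k, F ^ m * (C (b k) * q - F * h k)
      = ∑ i, (twist l (fun k => α k - m) (δ i) (∑ a, c a i * G a (k + 1))
          + weight l β (δ i) * ∑ a, c a i * G a k) := by
    intro k
    rw [hrel k]
    have h1 : ∀ a, twist l (fun k => α k - m) (F • pderiv a) (G a (k + 1))
        + weight l β (F • pderiv a) * G a k
        = ∑ i, (twist l (fun k => α k - m) (δ i) (c a i * G a (k + 1))
          + weight l β (δ i) * (c a i * G a k)) := by
      intro a
      rw [hF, hc a, twist_sum hl0 _ _ fun i => (DA l).smul_mem _ (hδ.mem i),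
        weight_sum hl0 _ _ fun i => (DA l).smul_mem _ (hδ.mem i), Finset.sum_mul,
        ← Finset.sum_add_distrib]
      refine Finset.sum_congr rfl fun i _ => ?_
      rw [twist_smul hl0 _ (hδ.mem i), weight_smul hl0 _ (hδ.mem i)]
      ring
    simp only [h1]
    rw [Finset.sum_comm]
    refine Finset.sum_congr rfl fun i _ => ?_
    rw [map_sum, Finset.mul_sum, Finset.sum_add_distrib]
  -- take homogeneous components
  have hd1 : ∀ i, d i - 1 + 1 = d i := by
    intro i
    by_cases hi : i = i₀
    · rw [hi, hδ.degree_euler]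
    · have := hδ.two_le i hi
      omega
  choose π hπ1 hπ2 hπ3 using fun i => exists_homogeneousComponent_twist hl0 hlh (hδ.mem i)
    (d := d i - 1) (by rw [hd1 i]; exact hδ.hom i) (j + p * m)
  have hcomp : ∀ k, ∃ h' : MvPolynomial (Fin n) ℂ, (h k = 0 → h' = 0) ∧
      F ^ m * (C (b k) * q) = F ^ (m + 1) * h'
        + ∑ i, (twist l (fun k => α k - m) (δ' i) (π i (∑ a, c a i * G a (k + 1)))
          + weight l β (δ' i) * π i (∑ a, c a i * G a k)) := by
    intro k
    have h1 : (F ^ m * (C (b k) * q)).IsHomogeneous (j + p * m) := by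
      have := (hFh.pow m).mul ((isHomogeneous_C (Fin n) (b k)).mul hqj)
      rwa [zero_add, add_comm] at this
    have h2 : ∃ h' : MvPolynomial (Fin n) ℂ, (h k = 0 → h' = 0) ∧
        homogeneousComponent (j + p * m) (F ^ (m + 1) * h k) = F ^ (m + 1) * h' := by
      by_cases hle : p * (m + 1) ≤ j + p * m
      · exact ⟨_, fun h0 => by rw [h0, map_zero],
          homogeneousComponent_mul_of_le (hFh.pow (m + 1)) hle _⟩
      · exact ⟨0, fun _ => rfl, by
          rw [homogeneousComponent_mul_of_lt (hFh.pow (m + 1)) (not_le.1 hle), mul_zero]⟩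
    obtain ⟨h', hh0, hh'⟩ := h2
    refine ⟨h', hh0, ?_⟩
    have h3 : F ^ m * (C (b k) * q) = F ^ (m + 1) * h k
        + ∑ i, (twist l (fun k => α k - m) (δ i) (∑ a, c a i * G a (k + 1))
          + weight l β (δ i) * ∑ a, c a i * G a k) := by
      rw [← hexp k]
      ring
    have h4 := congrArg (homogeneousComponent (j + p * m)) h3
    rw [homogeneousComponent_of_mem (m := j + p * m) ((mem_homogeneousSubmodule _ _).2 h1),
      if_pos rfl, map_add, hh', map_sum] at h4
    rw [h4]
    congr 1
    refine Finset.sum_congr rfl fun i _ => ?_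
    rw [map_add, hπ1, hπ2]
    by_cases hi : i = i₀
    · have h5 := hπ3 i (∑ a, c a i * G a (k + 1))
      rw [hi, hδ.degree_euler, Nat.sub_self, Nat.sub_zero] at h5
      rw [hi, hδ'0, twist_zero hl0, weight_zero hl0, zero_mul, hδ.euler,
        twist_euler hl0 hlh _ h5, weight_euler hl0 hlh, hβ0, Finset.sum_sub_distrib, hα]
      simp only [Finset.sum_const, Finset.card_univ, Fintype.card_fin, nsmul_eq_mul,
        Nat.cast_add, Nat.cast_mul]
      rw [show (j : ℂ) + p * m + n + (-(n + j) - p * m) = 0 by ring]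
      simp
    · rw [hδ'1 i hi]
  choose h' hh'0 hh' using hcomp
  obtain ⟨τ, hτ, hτ'⟩ : ∃ τ, b τ ≠ 0 ∧ ∀ k, τ < k → b k = 0 := by
    have hne : ((Finset.range (N + 1)).filter fun k => b k ≠ 0).Nonempty := by
      obtain ⟨k, hk⟩ := hb
      refine ⟨k, Finset.mem_filter.2 ⟨Finset.mem_range.2 ?_, hk⟩⟩
      by_contra hkN
      exact hk (hbN k (by omega))
    obtain ⟨τ, hτ, hmax⟩ := Finset.exists_max_image _ id hne
    refine ⟨τ, (Finset.mem_filter.1 hτ).2, fun k hk => ?_⟩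
    by_contra hbk
    have hkN : k < N + 1 := by
      by_contra hkN
      exact hbk (hbN k (by omega))
    have := hmax k (Finset.mem_filter.2 ⟨Finset.mem_range.2 hkN, hbk⟩)
    simp only [id] at this
    omega
  have hτN : τ ≤ N := by
    by_contra hlt
    exact hτ (hbN τ (by omega))
  obtain ⟨h'', v, hv⟩ := exists_leading_eq hl0 hδ'mem hδ'0 he (r := m + 1) (Nat.succ_ne_zero m)
    hV'
    (fun k => α k - m) (ρ := fun k => F ^ m * (C (b k) * q)) (τ := τ)
    (fun k hk => by rw [hτ' k hk, C_0, zero_mul, mul_zero]) N hτN h'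
    (fun i k => π i (∑ a, c a i * G a k)) hh' (fun k hk => hh'0 k (hhN k hk))
    (fun i k hk => by simp [hGN _ k hk])
  obtain ⟨u, hu⟩ := exists_eq_of_prod_pow_mul hl0 hδ'0 hm hV'
    (q := C (b τ) * q - F * h'') (g := v) (by
      rw [← hF, mul_sub, hv, ← hF]
      ring)
  have hq1 : q = C (b τ)⁻¹ * (F * h'' + ∑ i, weight l β (δ' i) * u i) := by
    rw [← hu, add_sub_cancel, ← mul_assoc, ← C_mul, inv_mul_cancel₀ hτ, C_1, one_mul]
  rw [hq1]
  refine Ideal.mul_mem_left _ _ (add_mem (Ideal.mul_mem_right _ _ (Ideal.subset_span ⟨i₀, ?_⟩))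
    (sum_mem fun i _ => ?_))
  · simp
  · by_cases hi : i = i₀
    · rw [hi, hδ'0, weight_zero hl0, zero_mul]
      exact zero_mem _
    · rw [hδ'1 i hi]
      exact Ideal.mul_mem_right _ _ (Ideal.subset_span ⟨i, by simp [hi]⟩)

end NoRelation

section TwistedOperators

variable {n p : ℕ} {M : Type*} [CommRing M] [Algebra ℂ M]
  [Algebra (MvPolynomial (Fin n ⊕ Fin p) ℂ) M]
  {D : Fin n → Module.End ℂ M}

/-- Modulo the images of the twisted derivatives, every operator generated by multiplications and
twisted derivatives acts by multiplication. -/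
theorem exists_mul_add_sum_of_mem_adjoin
    [IsScalarTower ℂ (MvPolynomial (Fin n ⊕ Fin p) ℂ) M]
    (hD : ∀ (i : Fin n) (r : MvPolynomial (Fin n ⊕ Fin p) ℂ) (m : M),
      D i (algebraMap _ M r * m) = algebraMap _ M (pderiv (Sum.inl i) r) * m
        + algebraMap _ M r * D i m) {P : Module.End ℂ M}
    (hP : P ∈ Algebra.adjoin ℂ
      ((Set.range fun i : Fin n => LinearMap.mulLeft ℂ
          (algebraMap (MvPolynomial (Fin n ⊕ Fin p) ℂ) M (X (Sum.inl i)))) ∪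
       (Set.range fun j : Fin p => LinearMap.mulLeft ℂ
          (algebraMap (MvPolynomial (Fin n ⊕ Fin p) ℂ) M (X (Sum.inr j)))) ∪ Set.range D))
    (q : MvPolynomial (Fin n ⊕ Fin p) ℂ) :
    ∃ h : MvPolynomial (Fin n ⊕ Fin p) ℂ, ∀ m : M, ∃ m' : Fin n → M,
      algebraMap _ M q * P m = algebraMap _ M h * m + ∑ k, D k (m' k) := by
  induction hP using Algebra.adjoin_induction generalizing q with
  | mem P hP =>
    rcases hP with (⟨i, rfl⟩ | ⟨j, rfl⟩) | ⟨i, rfl⟩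
    · exact ⟨q * X (Sum.inl i), fun m => ⟨0, by simp [mul_assoc]⟩⟩
    · exact ⟨q * X (Sum.inr j), fun m => ⟨0, by simp [mul_assoc]⟩⟩
    · refine ⟨-pderiv (Sum.inl i) q, fun m => ⟨Pi.single i (algebraMap _ M q * m), ?_⟩⟩
      classical
      rw [Finset.sum_eq_single_of_mem i (Finset.mem_univ i)]
      · rw [Pi.single_eq_same, hD, map_neg]
        ring
      · intro k _ hk
        rw [Pi.single_eq_of_ne hk, map_zero]
  | algebraMap c =>
    refine ⟨q * C c, fun m => ⟨0, ?_⟩⟩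
    have h : (algebraMap ℂ (Module.End ℂ M) c) m
        = algebraMap (MvPolynomial (Fin n ⊕ Fin p) ℂ) M (C c) * m := by
      rw [Module.algebraMap_end_apply, Algebra.smul_def,
        IsScalarTower.algebraMap_apply ℂ (MvPolynomial (Fin n ⊕ Fin p) ℂ) M]
      rfl
    rw [h]
    simp [mul_assoc]
  | add P P' _ _ ih ih' =>
    obtain ⟨h, hh⟩ := ih q
    obtain ⟨h', hh'⟩ := ih' q
    refine ⟨h + h', fun m => ?_⟩
    obtain ⟨v, hv⟩ := hh m
    obtain ⟨v', hv'⟩ := hh' m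
    refine ⟨v + v', ?_⟩
    simp only [LinearMap.add_apply, mul_add, hv, hv', map_add, Pi.add_apply,
      Finset.sum_add_distrib]
    ring
  | mul P P' _ _ ih ih' =>
    obtain ⟨h, hh⟩ := ih q
    obtain ⟨h', hh'⟩ := ih' h
    refine ⟨h', fun m => ?_⟩
    obtain ⟨v, hv⟩ := hh (P' m)
    obtain ⟨v', hv'⟩ := hh' m
    refine ⟨v' + v, ?_⟩
    simp only [Module.End.mul_apply, hv, hv', map_add, Pi.add_apply, Finset.sum_add_distrib]
    ring

/-- The numerator of the twisted derivative of `G / F ^ N`. -/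
theorem pow_mul_twisted
    (hD : ∀ (i : Fin n) (r : MvPolynomial (Fin n ⊕ Fin p) ℂ) (m : M),
      D i (algebraMap _ M r * m) = algebraMap _ M (pderiv (Sum.inl i) r) * m
        + algebraMap _ M r * D i m) {i : Fin n}
    {F Q : MvPolynomial (Fin n ⊕ Fin p) ℂ}
    (hQ : algebraMap _ M F * D i 1 = algebraMap _ M Q) (N : ℕ) {m : M}
    {G : MvPolynomial (Fin n ⊕ Fin p) ℂ} (hG : algebraMap _ M F ^ N * m = algebraMap _ M G) :
    algebraMap _ M F ^ (N + 1) * D i m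
      = algebraMap _ M (F * pderiv (Sum.inl i) G + Q * G - N * pderiv (Sum.inl i) F * G) := by
  have h1 := hD i (F ^ N) m
  have h2 := hD i G 1
  rw [map_pow, hG] at h1
  rw [mul_one, mul_one] at h2
  have h5 : algebraMap _ M F * (algebraMap _ M (pderiv (Sum.inl i) (F ^ N)) * m)
      = N * algebraMap _ M (pderiv (Sum.inl i) F) * algebraMap _ M G := by
    rw [← hG, Derivation.leibniz_pow]
    rcases N with _ | N
    · simp
    · simp only [Nat.add_sub_cancel, smul_eq_mul, nsmul_eq_mul, map_mul, map_pow, map_natCast]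
      ring
  simp only [map_sub, map_add, map_mul, map_natCast]
  rw [← hQ, ← h5]
  have h6 : algebraMap _ M F ^ N * D i m = algebraMap _ M (pderiv (Sum.inl i) G)
      + algebraMap _ M G * D i 1 - algebraMap _ M (pderiv (Sum.inl i) (F ^ N)) * m := by
    rw [← h2, h1]
    ring
  rw [pow_succ, mul_right_comm, h6]
  ring

/-- Clearing denominators in a functional equation. -/
theorem exists_polynomial_relation_of_mem_adjoin
    [IsScalarTower ℂ (MvPolynomial (Fin n ⊕ Fin p) ℂ) M]
    (hD : ∀ (i : Fin n) (r : MvPolynomial (Fin n ⊕ Fin p) ℂ) (m : M),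
      D i (algebraMap _ M r * m) = algebraMap _ M (pderiv (Sum.inl i) r) * m
        + algebraMap _ M r * D i m)
    {F : MvPolynomial (Fin n ⊕ Fin p) ℂ} {Q : Fin n → MvPolynomial (Fin n ⊕ Fin p) ℂ}
    (hQ : ∀ i, algebraMap _ M F * D i 1 = algebraMap _ M (Q i))
    [IsLocalization.Away F M] (hF : F ≠ 0)
    {P : Module.End ℂ M}
    (hP : P ∈ Algebra.adjoin ℂ
      ((Set.range fun i : Fin n => LinearMap.mulLeft ℂ
          (algebraMap (MvPolynomial (Fin n ⊕ Fin p) ℂ) M (X (Sum.inl i)))) ∪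
       (Set.range fun j : Fin p => LinearMap.mulLeft ℂ
          (algebraMap (MvPolynomial (Fin n ⊕ Fin p) ℂ) M (X (Sum.inr j)))) ∪ Set.range D))
    {B : MvPolynomial (Fin n ⊕ Fin p) ℂ} (hB : algebraMap _ M B = P (algebraMap _ M F))
    (q : MvPolynomial (Fin n ⊕ Fin p) ℂ) :
    ∃ (N : ℕ) (h : MvPolynomial (Fin n ⊕ Fin p) ℂ)
      (G : Fin n → MvPolynomial (Fin n ⊕ Fin p) ℂ),
      F ^ (N + 1) * (B * q - F * h)
        = ∑ i, (F * pderiv (Sum.inl i) (G i) + Q i * G i - N * pderiv (Sum.inl i) F * G i) := by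
  obtain ⟨h, hh⟩ := exists_mul_add_sum_of_mem_adjoin hD hP q
  obtain ⟨m, hm⟩ := hh (algebraMap _ M F)
  obtain ⟨⟨_, N, rfl⟩, hN⟩ := IsLocalization.exist_integer_multiples_of_finite
    (Submonoid.powers F) m
  choose G hG using hN
  refine ⟨N, h, G, ?_⟩
  have hinj : Function.Injective (algebraMap (MvPolynomial (Fin n ⊕ Fin p) ℂ) M) :=
    IsLocalization.injective M (powers_le_nonZeroDivisors_of_noZeroDivisors hF)
  apply hinj
  have h1 : ∀ i, algebraMap _ M F ^ N * m i = algebraMap _ M (G i) := by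
    intro i
    rw [hG i, Algebra.smul_def, map_pow]
  rw [map_sum, Finset.sum_congr rfl fun i _ => (pow_mul_twisted hD (hQ i) N (h1 i)).symm,
    ← Finset.mul_sum, map_mul, map_pow, map_sub, map_mul, map_mul, hB]
  congr 1
  linear_combination hm

end TwistedOperators

theorem exists_polynomial_relation {n p : ℕ} {l : Fin p → MvPolynomial (Fin n) ℂ}
    (hl0 : ∀ i, l i ≠ 0)
    {D : Fin n → Module.End ℂ
      (Localization.Away (rename Sum.inl (∏ i, l i) : MvPolynomial (Fin n ⊕ Fin p) ℂ))}
    (hD : IsTwisted l D) {b : MvPolynomial (Fin p) ℂ} (hb : b ∈ Bideal l D)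
    (q : MvPolynomial (Fin n ⊕ Fin p) ℂ) :
    ∃ (N : ℕ) (h : MvPolynomial (Fin n ⊕ Fin p) ℂ)
      (G : Fin n → MvPolynomial (Fin n ⊕ Fin p) ℂ),
      (rename Sum.inl (∏ i, l i) : MvPolynomial (Fin n ⊕ Fin p) ℂ) ^ (N + 1) *
          (rename Sum.inr b * q - rename Sum.inl (∏ i, l i) * h)
        = ∑ i, ((rename Sum.inl (∏ i, l i) : MvPolynomial (Fin n ⊕ Fin p) ℂ) *
            pderiv (Sum.inl i) (G i)
          + (∑ j, X (Sum.inr j) *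
            rename Sum.inl (pderiv i (l j) * ∏ k ∈ Finset.univ.erase j, l k)) * G i
          - N * pderiv (Sum.inl i)
            (rename Sum.inl (∏ i, l i) : MvPolynomial (Fin n ⊕ Fin p) ℂ) * G i) := by
  obtain ⟨P, hP, hbP⟩ := hb
  have hF : (rename Sum.inl (∏ i, l i) : MvPolynomial (Fin n ⊕ Fin p) ℂ) ≠ 0 := by
    rw [Ne, map_eq_zero_iff _ (rename_injective _ Sum.inl_injective)]
    exact Finset.prod_ne_zero_iff.2 fun k _ => hl0 k
  unfold Wa at hP
  refine exists_polynomial_relation_of_mem_adjoin hD.1 (fun i => ?_) hF hP hbP q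
  convert hD.2 i

section Substitution

variable {n p : ℕ}

/-- The substitution `s_k ↦ α_k + β_k t`. -/
noncomputable def lineSubst (n : ℕ) (α β : Fin p → ℂ) :
    MvPolynomial (Fin n ⊕ Fin p) ℂ →ₐ[ℂ] Polynomial (MvPolynomial (Fin n) ℂ) :=
  aeval (Sum.elim (fun i => Polynomial.C (X i))
    (fun k => Polynomial.C (C (α k)) + Polynomial.C (C (β k)) * Polynomial.X))

theorem lineSubst_rename_inl (α β : Fin p → ℂ) (g : MvPolynomial (Fin n) ℂ) :
    lineSubst n α β (rename Sum.inl g) = Polynomial.C g := by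
  rw [lineSubst, aeval_rename]
  induction g using MvPolynomial.induction_on with
  | C a => simp [Polynomial.algebraMap_apply]
  | add f g hf hg => rw [map_add, map_add, hf, hg]
  | mul_X f i hf => rw [map_mul, map_mul, hf, aeval_X]; rfl

theorem lineSubst_X_inr (α β : Fin p → ℂ) (k : Fin p) :
    lineSubst n α β (X (Sum.inr k))
      = Polynomial.C (C (α k)) + Polynomial.C (C (β k)) * Polynomial.X := by
  rw [lineSubst, aeval_X, Sum.elim_inr]

theorem exists_lineSubst_rename_inr (α β : Fin p → ℂ) (b : MvPolynomial (Fin p) ℂ) :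
    ∃ c : Polynomial ℂ, lineSubst n α β (rename Sum.inr b) = c.map C ∧ c.coeff 0 = eval α b := by
  induction b using MvPolynomial.induction_on with
  | C a =>
    refine ⟨Polynomial.C a, ?_, by simp⟩
    simp [Polynomial.algebraMap_apply, MvPolynomial.algebraMap_eq, lineSubst]
  | add f g hf hg =>
    obtain ⟨c, h1, h2⟩ := hf
    obtain ⟨c', h1', h2'⟩ := hg
    exact ⟨c + c', by simp [h1, h1'], by simp [h2, h2']⟩
  | mul_X f i hf =>
    obtain ⟨c, h1, h2⟩ := hf
    refine ⟨c * (Polynomial.C (α i) + Polynomial.C (β i) * Polynomial.X), ?_, ?_⟩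
    · simp [h1, lineSubst_X_inr]
    · simp [h2, Polynomial.mul_coeff_zero]

theorem coeff_lineSubst_pderiv (α β : Fin p → ℂ) (i : Fin n)
    (G : MvPolynomial (Fin n ⊕ Fin p) ℂ) (k : ℕ) :
    (lineSubst n α β (pderiv (Sum.inl i) G)).coeff k
      = pderiv i ((lineSubst n α β G).coeff k) := by
  classical
  induction G using MvPolynomial.induction_on generalizing k with
  | C a =>
    simp [Polynomial.algebraMap_apply, MvPolynomial.algebraMap_eq, lineSubst, Polynomial.coeff_C,
      apply_ite]
  | add f g hf hg => simp [hf, hg]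
  | mul_X f j hf =>
    rw [pderiv_mul]
    rcases j with j | j
    · have h1 : lineSubst n α β (X (Sum.inl j)) = Polynomial.C (X j) := by
        rw [lineSubst, aeval_X, Sum.elim_inl]
      have h2 : lineSubst n α β (pderiv (Sum.inl i) (X (Sum.inl j)))
          = Polynomial.C (pderiv i (X j)) := by
        by_cases h : i = j
        · subst h; simp
        · rw [pderiv_X_of_ne (by simpa using Ne.symm h), pderiv_X_of_ne (Ne.symm h)]; simp
      simp only [map_add, map_mul, h1, h2, Polynomial.coeff_add, Polynomial.coeff_mul_C, hf,
        pderiv_mul]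
    · rw [pderiv_X_of_ne (by simp), mul_zero, add_zero, map_mul, map_mul, lineSubst_X_inr,
        mul_add, mul_add, ← mul_assoc, ← mul_assoc]
      rcases k with _ | k
      · simp [hf, Polynomial.mul_coeff_zero, mul_comm (C (α j))]
      · simp only [Polynomial.coeff_add, Polynomial.coeff_mul_C, Polynomial.coeff_mul_X, hf,
          map_add, pderiv_mul, pderiv_C, mul_zero, add_zero]

variable {l : Fin p → MvPolynomial (Fin n) ℂ}

theorem logPart_prod_smul_pderiv (hl0 : ∀ i, l i ≠ 0) (i : Fin n) (k : Fin p) :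
    logPart l ((∏ k, l k) • pderiv i) k = pderiv i (l k) * ∏ m ∈ Finset.univ.erase k, l m := by
  refine logPart_eq hl0 ?_
  rw [Derivation.coe_smul, Pi.smul_apply, smul_eq_mul,
    ← Finset.mul_prod_erase Finset.univ l (Finset.mem_univ k)]
  ring

theorem lineSubst_numerator (hl0 : ∀ i, l i ≠ 0) (α β : Fin p → ℂ) (i : Fin n) :
    lineSubst n α β (∑ k, X (Sum.inr k) *
        rename Sum.inl (pderiv i (l k) * ∏ m ∈ Finset.univ.erase k, l m))
      = Polynomial.C (weight l α ((∏ k, l k) • pderiv i))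
        + Polynomial.C (weight l β ((∏ k, l k) • pderiv i)) * Polynomial.X := by
  simp only [map_sum, map_mul (lineSubst n α β), lineSubst_X_inr, lineSubst_rename_inl, weight,
    ← logPart_prod_smul_pderiv hl0, Finset.sum_mul, ← Finset.sum_add_distrib]
  refine Finset.sum_congr rfl fun k _ => ?_
  simp only [map_mul]
  ring

theorem twist_prod_smul_pderiv (hl0 : ∀ i, l i ≠ 0) (α : Fin p → ℂ) (N : ℕ) (i : Fin n)
    (g : MvPolynomial (Fin n) ℂ) :
    twist l (fun k => α k - (N + 1 : ℕ)) ((∏ k, l k) • pderiv i) g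
      = (∏ k, l k) * pderiv i g + weight l α ((∏ k, l k) • pderiv i) * g
        - N * pderiv i (∏ k, l k) * g := by
  have hmem := prod_smul_mem_DA (l := l) (pderiv i)
  have hF0 : ∏ k, l k ≠ 0 := Finset.prod_ne_zero_iff.2 fun k _ => hl0 k
  have h1 : divergence ((∏ k, l k) • pderiv i) = pderiv i (∏ k, l k) := by
    rw [divergence_smul]
    simp only [divergence]
    rw [Finset.sum_eq_zero, mul_zero, zero_add]
    intro k _
    by_cases h : k = i
    · subst h; simp
    · rw [pderiv_X_of_ne h, map_zero]
  have h2 : ∑ k, logPart l ((∏ k, l k) • pderiv i) k = pderiv i (∏ k, l k) := by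
    have h := derivation_prod_pow hmem 1
    rw [pow_one, Nat.cast_one, one_mul, Derivation.coe_smul, Pi.smul_apply, smul_eq_mul] at h
    exact (mul_left_cancel₀ hF0 h).symm
  have h3 : weight l (fun k => α k - (N + 1 : ℕ)) ((∏ k, l k) • pderiv i)
      = weight l α ((∏ k, l k) • pderiv i) - (N + 1) * pderiv i (∏ k, l k) := by
    rw [← h2]
    simp only [weight, map_sub, sub_mul, Finset.sum_sub_distrib, Finset.mul_sum]
    simp
  rw [twist_apply, h1, h3, Derivation.coe_smul, Pi.smul_apply, smul_eq_mul]
  ring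

theorem eval_eq_zero_of_mem_Bideal (hp : 1 ≤ p) (hl0 : ∀ i, l i ≠ 0)
    (hlh : ∀ i, (l i).IsHomogeneous 1) (hprop : ∀ i j, i ≠ j → ∀ c : ℂ, l i ≠ c • l j)
    (hfree : Module.Free (MvPolynomial (Fin n) ℂ) (DA l))
    (hirr : IrredOn l Finset.univ) (hess : (⨅ i, hyp l i) = ⊥)
    {D : Fin n → Module.End ℂ
      (Localization.Away (rename Sum.inl (∏ i, l i) : MvPolynomial (Fin n ⊕ Fin p) ℂ))}
    (hD : IsTwisted l D) {b : MvPolynomial (Fin p) ℂ} (hb : b ∈ Bideal l D)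
    {j : ℕ} (hj : j ≤ 2 * (p - n)) {α : Fin p → ℂ} (hα : ∑ k, α k = -((n : ℂ) + j)) :
    eval α b = 0 := by
  obtain ⟨β, q, H⟩ := exists_no_relation hp hl0 hlh hprop hfree hirr hess hj
  obtain ⟨N, h, G, hG⟩ := exists_polynomial_relation hl0 hD hb (rename Sum.inl q)
  obtain ⟨c, hc, hc0⟩ := exists_lineSubst_rename_inr (n := n) α β b
  by_contra hne
  refine H α (N + 1) c.coeff
    (c.natDegree + (lineSubst n α β h).natDegree
      + ∑ i, (Polynomial.X * lineSubst n α β (G i)).natDegree)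
    (lineSubst n α β h).coeff (fun i => (Polynomial.X * lineSubst n α β (G i)).coeff)
    hα N.succ_ne_zero ⟨0, hc0.trans_ne hne⟩
    (fun k hk => Polynomial.coeff_eq_zero_of_natDegree_lt (by omega))
    (fun k hk => Polynomial.coeff_eq_zero_of_natDegree_lt (by omega))
    (fun i k hk => Polynomial.coeff_eq_zero_of_natDegree_lt ?_) fun k => ?_
  · have := Finset.single_le_sum
      (f := fun i => (Polynomial.X * lineSubst n α β (G i)).natDegree)
      (fun _ _ => Nat.zero_le _) (Finset.mem_univ i)
    omega
  · have h1 := congrArg (fun f => (lineSubst n α β f).coeff k) hG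
    simp only [map_mul (lineSubst n α β), map_pow, map_sub, lineSubst_rename_inl, hc] at h1
    rw [← Polynomial.C_pow, Polynomial.coeff_C_mul, Polynomial.coeff_sub, Polynomial.coeff_mul_C,
      Polynomial.coeff_C_mul, Polynomial.coeff_map] at h1
    rw [h1, map_sum, Polynomial.finsetSum_coeff]
    refine Finset.sum_congr rfl fun i _ => ?_
    rw [Polynomial.coeff_X_mul, twist_prod_smul_pderiv hl0, map_sub, map_add,
      map_mul (lineSubst n α β), map_mul (lineSubst n α β), map_mul (lineSubst n α β),
      map_mul (lineSubst n α β), lineSubst_numerator hl0,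
      pderiv_rename Sum.inl_injective, lineSubst_rename_inl, lineSubst_rename_inl, map_natCast,
      ← Polynomial.C_eq_natCast, Polynomial.coeff_sub, Polynomial.coeff_add,
      Polynomial.coeff_C_mul, coeff_lineSubst_pderiv, ← Polynomial.C_mul, Polynomial.coeff_C_mul,
      add_mul, Polynomial.coeff_add, mul_assoc (Polynomial.C _) Polynomial.X,
      Polynomial.coeff_C_mul, Polynomial.coeff_C_mul]
    ring

end Substitution

section Divisibility

theorem isCoprime_add_C {σ : Type*} {f : MvPolynomial σ ℂ} {a c : ℂ} (h : a ≠ c) :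
    IsCoprime (f + C a) (f + C c) := by
  refine ⟨C (a - c)⁻¹, -C (a - c)⁻¹, ?_⟩
  have h1 : (C (a - c)⁻¹ * C (a - c) : MvPolynomial σ ℂ) = 1 := by
    rw [← C_mul, inv_mul_cancel₀ (sub_ne_zero.2 h), C_1]
  rw [C_sub] at h1
  linear_combination h1

variable {σ : Type*} [Fintype σ]

theorem sum_X_add_C_dvd_of_eval_eq_zero [Nonempty σ] {c : ℂ} {b : MvPolynomial σ ℂ}
    (hb : ∀ α : σ → ℂ, ∑ i, α i = -c → eval α b = 0) : (∑ i, X i) + C c ∣ b := by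
  classical
  obtain ⟨k⟩ := ‹Nonempty σ›
  set L : MvPolynomial σ ℂ := (∑ i, X i) + C c with hL
  let ψ : MvPolynomial σ ℂ →ₐ[ℂ] MvPolynomial σ ℂ := aeval (X - Pi.single k L)
  have h1 : (Ideal.Quotient.mkₐ ℂ (Ideal.span {L})).comp ψ
      = Ideal.Quotient.mkₐ ℂ (Ideal.span {L}) := by
    refine algHom_ext fun i => ?_
    rw [AlgHom.comp_apply, aeval_X, Pi.sub_apply, map_sub, sub_eq_self, Ideal.Quotient.mkₐ_eq_mk,
      Ideal.Quotient.eq_zero_iff_mem, Ideal.mem_span_singleton]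
    by_cases h : i = k
    · subst h; simp
    · simp [h]
  have h2 : ∀ x : σ → ℂ, eval x (ψ b) = eval (x - Pi.single k (eval x L)) b := by
    intro x
    have h : ((eval x).comp ψ.toRingHom) = eval (x - Pi.single k (eval x L)) := by
      refine ringHom_ext (fun a => ?_) fun i => ?_
      · simp
      · change eval x (ψ (X i)) = _
        rw [aeval_X, Pi.sub_apply, map_sub, eval_X, eval_X, Pi.sub_apply]
        by_cases h : i = k
        · subst h; rw [Pi.single_eq_same, Pi.single_eq_same]
        · rw [Pi.single_eq_of_ne h, Pi.single_eq_of_ne h, map_zero]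
    exact DFunLike.congr_fun h b
  have h2' : ψ b = 0 := by
    refine MvPolynomial.funext fun x => ?_
    rw [map_zero, h2]
    refine hb _ ?_
    simp only [Pi.sub_apply, Finset.sum_sub_distrib, Finset.sum_pi_single', Finset.mem_univ,
      if_true, hL, map_add, map_sum, eval_X, eval_C]
    ring
  have h3 := DFunLike.congr_fun h1 b
  rw [AlgHom.comp_apply, h2', map_zero, Ideal.Quotient.mkₐ_eq_mk] at h3
  exact Ideal.mem_span_singleton.1 (Ideal.Quotient.eq_zero_iff_mem.1 h3.symm)

end Divisibility

end Arrangement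

open Arrangement in
/-- If the central arrangement defined by `l₁,…,l_p` is free, irreducible
and essential, then every element of the Bernstein ideal is divisible by
`∏_{j=0}^{2(p−n)} (s₁ + ⋯ + s_p + n + j)`. -/
theorem dvd_of_mem_bernstein_ideal_of_irreducible
    (n p : ℕ) (hp : 1 ≤ p) (l : Fin p → MvPolynomial (Fin n) ℂ)
    (hl0 : ∀ i, l i ≠ 0) (hlh : ∀ i, (l i).IsHomogeneous 1)
    (hprop : ∀ i j, i ≠ j → ∀ c : ℂ, l i ≠ c • l j)
    (hfree : Module.Free (MvPolynomial (Fin n) ℂ) (DA l))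
    (hirr : IrredOn l Finset.univ)
    (hess : (⨅ i, hyp l i) = ⊥)
    (D : Fin n → Module.End ℂ
      (Localization.Away (rename Sum.inl (∏ i, l i) : MvPolynomial (Fin n ⊕ Fin p) ℂ)))
    (hD : IsTwisted l D) :
    ∀ b ∈ Bideal l D,
      (∏ j ∈ Finset.range (2 * (p - n) + 1), ((∑ i, X i) + C ((n : ℂ) + (j : ℂ)))) ∣ b := by
  intro b hb
  have : Nonempty (Fin p) := ⟨⟨0, hp⟩⟩
  refine Finset.prod_dvd_of_coprime (fun i _ j _ hij => isCoprime_add_C fun h => hij ?_) fun j hj =>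
    sum_X_add_C_dvd_of_eval_eq_zero fun α hα => ?_
  · exact Nat.cast_injective (add_left_cancel h)
  · exact eval_eq_zero_of_mem_Bideal hp hl0 hlh hprop hfree hirr hess hD hb
      (Nat.lt_succ_iff.1 (Finset.mem_range.1 hj)) hα
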